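/- arXiv:1005.4987 — 3 statements merged into one kernel-verified Lean document; each statement's English description precedes it below -/
import Mathlib

section
/- Let (X,w) be a Euclidean 6-design in ℝ^22 supported by exactly two concentric spheres of positive radii r1, r2 centered at the origin, with fibers X1 and X2, |X| = 2300 and |X1| = 275. Then each fiber is a spherical 4-design on its sphere: for every polynomial f on ℝ^22 of total degree at most 4, (1/|S_i|)∫_{S_i} f dσ_i = (1/|X_i|) Σ_{x∈X_i} f(x) for i = 1, 2. -/
open MeasureTheory Metric MvPolynomial
open scoped RealInnerProductSpace Classical

/-- Average of a polynomial over the sphere of radius `r` centered at the origin in `ℝⁿ`,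
with respect to the (rotation-invariant, normalized) surface measure. -/
noncomputable def sphereAvg (n : ℕ) (r : ℝ) (f : MvPolynomial (Fin n) ℝ) : ℝ :=
  ⨍ u : sphere (0 : EuclideanSpace ℝ (Fin n)) 1,
    eval (fun i => r * (u : EuclideanSpace ℝ (Fin n)) i) f
    ∂((volume : Measure (EuclideanSpace ℝ (Fin n))).toSphere)

/-- `(X₁ ∪ X₂, w)` is a Euclidean `t`-design of `ℝ²²` supported by the two concentric spheres
of radii `r₁` and `r₂` centered at the origin, with fibers `X₁ ⊆ S(0,r₁)` and `X₂ ⊆ S(0,r₂)`. -/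
def IsEuclideanDesignTwoSpheres (t : ℕ) (X₁ X₂ : Finset (EuclideanSpace ℝ (Fin 22)))
    (w : EuclideanSpace ℝ (Fin 22) → ℝ) (r₁ r₂ : ℝ) : Prop :=
  ∀ f : MvPolynomial (Fin 22) ℝ, f.totalDegree ≤ t →
    (∑ x ∈ X₁, w x) * sphereAvg 22 r₁ f + (∑ x ∈ X₂, w x) * sphereAvg 22 r₂ f
      = ∑ x ∈ X₁ ∪ X₂, w x * eval (x : Fin 22 → ℝ) f

section SphereAverage

variable {n : ℕ}

lemma continuous_eval_sphere (r : ℝ) (f : MvPolynomial (Fin n) ℝ) :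
    Continuous fun u : sphere (0 : EuclideanSpace ℝ (Fin n)) 1 =>
      eval (fun i => r * (u : EuclideanSpace ℝ (Fin n)) i) f :=
  (MvPolynomial.continuous_eval f).comp (by fun_prop)

open scoped Pointwise in
lemma measurePreserving_toSphere {E : Type*} [NormedAddCommGroup E] [InnerProductSpace ℝ E]
    [FiniteDimensional ℝ E] [MeasurableSpace E] [BorelSpace E] (R : E ≃ₗᵢ[ℝ] E)
    {T : sphere (0 : E) 1 → sphere (0 : E) 1} (hT : ∀ u, (T u : E) = R u) :
    MeasurePreserving T (volume : Measure E).toSphere (volume : Measure E).toSphere := by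
  have hTm : Measurable T := by
    refine (continuous_induced_rng.2 ?_).measurable
    simpa only [Function.comp_def, hT] using R.continuous.comp continuous_subtype_val
  refine ⟨hTm, Measure.ext fun s hs => ?_⟩
  rw [Measure.map_apply hTm hs, Measure.toSphere_apply' _ (hTm hs), Measure.toSphere_apply' _ hs]
  congr 1
  have hR : MeasurePreserving R.toMeasurableEquiv (volume : Measure E) volume :=
    R.measurePreserving
  rw [← hR.measure_preimage_equiv (Set.Ioo (0 : ℝ) 1 • (((↑) : sphere (0 : E) 1 → E) '' s))]
  congr 1
  ext x
  simp only [Set.mem_smul, Set.mem_preimage, Set.mem_image, Subtype.exists, exists_and_right]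
  constructor
  · rintro ⟨c, hc, _, ⟨u, ⟨hu, hus⟩, rfl⟩, rfl⟩
    refine ⟨c, hc, R u, ⟨T ⟨u, hu⟩, ⟨(T ⟨u, hu⟩).2, hus⟩, hT _⟩, ?_⟩
    simp
  · rintro ⟨c, hc, v, ⟨u, ⟨hu, hus⟩, huv⟩, hcx⟩
    have hv : R.symm u ∈ sphere (0 : E) 1 := by simpa using hu
    refine ⟨c, hc, R.symm u, ⟨_, ⟨hv, ?_⟩, rfl⟩, ?_⟩
    · have : T ⟨R.symm u, hv⟩ = ⟨u, hu⟩ := Subtype.ext (by simp [hT])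
      rwa [this]
    · apply R.injective
      simp only [map_smul, LinearIsometryEquiv.apply_symm_apply]
      subst huv; exact hcx

lemma sphereAvg_congr_isometry (r : ℝ) {f g : MvPolynomial (Fin n) ℝ}
    (R : EuclideanSpace ℝ (Fin n) ≃ₗᵢ[ℝ] EuclideanSpace ℝ (Fin n))
    (h : ∀ x : EuclideanSpace ℝ (Fin n), eval (x : Fin n → ℝ) g = eval (R x : Fin n → ℝ) f) :
    sphereAvg n r g = sphereAvg n r f := by
  let T : sphere (0 : EuclideanSpace ℝ (Fin n)) 1 ≃ₜ sphere (0 : EuclideanSpace ℝ (Fin n)) 1 :=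
    R.toHomeomorph.subtype (by simp)
  have hT := measurePreserving_toSphere R (T := T) (fun _ => rfl)
  unfold sphereAvg
  rw [average_eq, average_eq, ← hT.integral_comp T.measurableEmbedding
    (fun u => eval (fun i => r * (u : EuclideanSpace ℝ (Fin n)) i) f)]
  congr 2
  ext u
  have := h (r • (u : EuclideanSpace ℝ (Fin n)))
  rw [map_smul] at this
  exact this

lemma sphereAvg_nonneg (r : ℝ) {f : MvPolynomial (Fin n) ℝ} (hf : ∀ x, 0 ≤ eval x f) :
    0 ≤ sphereAvg n r f := by
  unfold sphereAvg
  rw [average_eq]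
  exact smul_nonneg (by positivity) (integral_nonneg fun u => hf _)

lemma eval_eq_zero_of_sphereAvg_eq_zero (r : ℝ) {f : MvPolynomial (Fin n) ℝ}
    (hf : ∀ x, 0 ≤ eval x f) (h : sphereAvg n r f = 0)
    (u : sphere (0 : EuclideanSpace ℝ (Fin n)) 1) :
    eval (fun i => r * (u : EuclideanSpace ℝ (Fin n)) i) f = 0 := by
  have hc := continuous_eval_sphere r f
  have hne : (volume : Measure (EuclideanSpace ℝ (Fin n))).toSphere ≠ 0 := by
    have : Nontrivial (EuclideanSpace ℝ (Fin n)) :=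
      ⟨u, 0, fun h0 => by have := norm_eq_of_mem_sphere u; simp [h0] at this⟩
    exact Measure.toSphere_ne_zero _
  unfold sphereAvg at h
  rw [average_eq, smul_eq_zero] at h
  have h0 := h.resolve_left (by
    rw [inv_eq_zero, measureReal_eq_zero_iff, Measure.measure_univ_eq_zero]; exact hne)
  rw [integral_eq_zero_iff_of_nonneg (fun u => hf _)
    (hc.integrable_of_hasCompactSupport (HasCompactSupport.of_compactSpace _))] at h0
  exact congrFun ((hc.ae_eq_iff_eq _ continuous_const).1 h0) u

lemma sphereAvg_eq_mul (r c : ℝ) {f g : MvPolynomial (Fin n) ℝ}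
    (h : ∀ x : EuclideanSpace ℝ (Fin n), ‖x‖ = |r| →
      eval (x : Fin n → ℝ) g = c * eval (x : Fin n → ℝ) f) :
    sphereAvg n r g = c * sphereAvg n r f := by
  have hu : ∀ u : sphere (0 : EuclideanSpace ℝ (Fin n)) 1,
      eval (fun i => r * (u : EuclideanSpace ℝ (Fin n)) i) g =
        c * eval (fun i => r * (u : EuclideanSpace ℝ (Fin n)) i) f := fun u =>
    h (r • (u : EuclideanSpace ℝ (Fin n))) (by
      rw [norm_smul, norm_eq_of_mem_sphere, mul_one, Real.norm_eq_abs])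
  unfold sphereAvg
  simp only [hu, average_eq, smul_eq_mul, integral_const_mul]
  ring

end SphereAverage

section Polynomials

variable {n : ℕ}

lemma exists_eval_comp_linear
    (L : EuclideanSpace ℝ (Fin n) →ₗ[ℝ] EuclideanSpace ℝ (Fin n)) (f : MvPolynomial (Fin n) ℝ) :
    ∃ g : MvPolynomial (Fin n) ℝ, g.totalDegree ≤ f.totalDegree ∧
      ∀ x : EuclideanSpace ℝ (Fin n), eval (x : Fin n → ℝ) g = eval (L x : Fin n → ℝ) f := by
  let ℓ : Fin n → MvPolynomial (Fin n) ℝ := fun i =>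
    ∑ j, C (L (EuclideanSpace.single j 1) i) * X j
  have hℓ : ∀ i, (ℓ i).totalDegree ≤ 1 := fun i =>
    totalDegree_finsetSum_le fun j _ => (totalDegree_mul _ _).trans (by simp)
  refine ⟨bind₁ ℓ f, ?_, fun x => ?_⟩
  · conv_lhs => rw [f.as_sum, map_sum]
    refine totalDegree_finsetSum_le fun d hd => ?_
    rw [bind₁_monomial]
    refine (totalDegree_mul _ _).trans ?_
    rw [totalDegree_C, zero_add]
    refine (totalDegree_finsetProd _ _).trans ((Finset.sum_le_sum fun i _ => ?_).trans
      (le_totalDegree hd))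
    exact (totalDegree_pow _ _).trans (mul_le_of_le_one_right' (hℓ i))
  · have hx : ∀ i, eval (x : Fin n → ℝ) (ℓ i) = L x i := fun i => by
      have h1 : x = ∑ j, x j • EuclideanSpace.single j (1 : ℝ) := by
        ext k; simp [Pi.single_apply]
      conv_rhs => rw [h1]
      simp [ℓ, mul_comm]
    rw [← aeval_eq_eval, ← aeval_eq_eval, aeval_bind₁]
    simp only [aeval_eq_eval, hx]

lemma exists_lagrange {k : ℕ} {Y : Finset (EuclideanSpace ℝ (Fin n))}
    (hcard : Y.card = ∑ i ∈ Finset.range (k + 1), (n + i - 1).choose i)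
    (hinj : ∀ f : MvPolynomial (Fin n) ℝ, f.totalDegree ≤ k →
      (∀ x ∈ Y, eval (x : Fin n → ℝ) f = 0) → f = 0)
    (x : EuclideanSpace ℝ (Fin n)) :
    ∃ f : MvPolynomial (Fin n) ℝ, f.totalDegree ≤ k ∧
      ∀ y ∈ Y, eval (y : Fin n → ℝ) f = if y = x then 1 else 0 := by
  let T : Finset (Fin n →₀ ℕ) :=
    (Finset.range (k + 1)).biUnion fun i => Finset.finsuppAntidiag Finset.univ i
  have hT : T.card = Y.card := by
    rw [hcard, Finset.card_biUnion]
    · simp [Finset.card_finsuppAntidiag_nat_eq_choose]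
    · intro i _ j _ hij
      refine Finset.disjoint_left.2 fun d hd hd' => hij ?_
      rw [Finset.mem_finsuppAntidiag] at hd hd'
      exact hd.1.symm.trans hd'.1
  let P : (T → ℝ) →ₗ[ℝ] MvPolynomial (Fin n) ℝ :=
    ∑ d : T, (monomial (d : Fin n →₀ ℕ)).comp (LinearMap.proj d)
  have hP : ∀ c, P c = ∑ d : T, monomial (d : Fin n →₀ ℕ) (c d) := fun c => by simp [P]
  have hPdeg : ∀ c, (P c).totalDegree ≤ k := fun c => by
    rw [hP]
    refine totalDegree_finsetSum_le fun d _ => (totalDegree_monomial_le _ _).trans ?_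
    obtain ⟨i, hi, hd⟩ := Finset.mem_biUnion.1 d.2
    rw [Finset.mem_finsuppAntidiag] at hd
    rw [Finset.mem_range] at hi
    have : ((d : Fin n →₀ ℕ).sum fun _ => id) = i := by
      rw [Finsupp.sum_fintype _ _ (by simp)]; exact hd.1
    omega
  have hcoeff : ∀ c (d : T), coeff (d : Fin n →₀ ℕ) (P c) = c d := fun c d => by
    rw [hP, coeff_sum]
    simp [coeff_monomial]
  let L : (T → ℝ) →ₗ[ℝ] (Y → ℝ) :=
    LinearMap.pi fun y =>
      ((aeval (y.1 : Fin n → ℝ)).toLinearMap : MvPolynomial (Fin n) ℝ →ₗ[ℝ] ℝ) ∘ₗ P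
  have hL : ∀ c y, L c y = eval (y.1 : Fin n → ℝ) (P c) := fun c y => by
    simp [L, aeval_eq_eval]
  have hLinj : Function.Injective L := by
    rw [← LinearMap.ker_eq_bot, LinearMap.ker_eq_bot']
    intro c hc
    have : P c = 0 := hinj _ (hPdeg c) fun y hy => by
      rw [← hL c ⟨y, hy⟩, hc]; rfl
    ext d
    rw [← hcoeff c d, this]; simp
  have hLsurj := (LinearMap.injective_iff_surjective_of_finrank_eq_finrank
    (f := L) (by simp [hT])).1 hLinj
  obtain ⟨c, hc⟩ := hLsurj fun y => if y.1 = x then 1 else 0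
  exact ⟨P c, hPdeg c, fun y hy => by rw [← hL c ⟨y, hy⟩, hc]⟩

lemma eq_zero_of_eval_two_spheres {r₁ r₂ : ℝ} (hr₁ : 0 < r₁) (hr₂ : 0 < r₂) (hrne : r₁ ≠ r₂)
    {f : MvPolynomial (Fin n) ℝ} (hf : f.totalDegree ≤ 3) (hn : 0 < n)
    (h₁ : ∀ u : sphere (0 : EuclideanSpace ℝ (Fin n)) 1,
      eval (fun i => r₁ * (u : EuclideanSpace ℝ (Fin n)) i) f = 0)
    (h₂ : ∀ u : sphere (0 : EuclideanSpace ℝ (Fin n)) 1,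
      eval (fun i => r₂ * (u : EuclideanSpace ℝ (Fin n)) i) f = 0) :
    f = 0 := by
  have key : ∀ (u : sphere (0 : EuclideanSpace ℝ (Fin n)) 1) (t : ℝ),
      eval (fun i => t * (u : EuclideanSpace ℝ (Fin n)) i) f = 0 := by
    intro u t
    let p : Polynomial ℝ := aeval (fun i =>
      Polynomial.X * Polynomial.C ((u : EuclideanSpace ℝ (Fin n)) i)) f
    have hp : ∀ s, p.eval s = eval (fun i => s * (u : EuclideanSpace ℝ (Fin n)) i) f := by
      intro s
      simp only [p, aeval_def, eval₂_eq, eval_eq, Polynomial.eval_finsetSum]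
      simp [Polynomial.eval_prod, mul_comm s]
    have hdeg : p.natDegree ≤ 3 := by
      simp only [p, aeval_def, eval₂_eq]
      refine Polynomial.natDegree_sum_le_of_forall_le _ _ fun d hd => ?_
      refine Polynomial.natDegree_mul_le.trans ?_
      rw [Polynomial.algebraMap_eq, Polynomial.natDegree_C, zero_add]
      refine (Polynomial.natDegree_prod_le _ _).trans (le_trans ?_ ((le_totalDegree hd).trans hf))
      refine Finset.sum_le_sum fun i _ => Polynomial.natDegree_pow_le.trans ?_
      refine mul_le_of_le_one_right' (Polynomial.natDegree_mul_le.trans ?_)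
      simp
    have hneg : ∀ s, eval (fun i => -s * (u : EuclideanSpace ℝ (Fin n)) i) f =
        eval (fun i => s * ((-u : sphere (0 : EuclideanSpace ℝ (Fin n)) 1) :
          EuclideanSpace ℝ (Fin n)) i) f := fun s => by simp
    have hp0 : p = 0 := by
      refine Polynomial.eq_zero_of_natDegree_lt_card_of_eval_eq_zero' p {r₁, r₂, -r₁, -r₂} ?_ ?_
      · simp only [Finset.mem_insert, Finset.mem_singleton]
        rintro s (rfl | rfl | rfl | rfl)
        · rw [hp, h₁]
        · rw [hp, h₂]
        · rw [hp, hneg, h₁]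
        · rw [hp, hneg, h₂]
      · rw [Finset.card_insert_of_notMem, Finset.card_insert_of_notMem, Finset.card_pair]
        · omega
        · intro h; apply hrne; linarith
        · simp only [Finset.mem_insert, Finset.mem_singleton]
          rintro (h | h) <;> linarith
        · simp only [Finset.mem_insert, Finset.mem_singleton]
          rintro (h | h | h)
          · exact hrne h
          all_goals linarith
    rw [← hp, hp0, Polynomial.eval_zero]
  refine MvPolynomial.funext fun x => ?_
  rw [map_zero]
  let y : EuclideanSpace ℝ (Fin n) := WithLp.toLp 2 x
  by_cases hy : y = 0
  · let u : sphere (0 : EuclideanSpace ℝ (Fin n)) 1 :=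
      ⟨EuclideanSpace.single ⟨0, hn⟩ 1, by simp⟩
    have := key u 0
    have hx : x = fun i => 0 * (u : EuclideanSpace ℝ (Fin n)) i := by
      ext i
      have := congrArg (fun z : EuclideanSpace ℝ (Fin n) => z i) hy
      simpa [y] using this
    rwa [hx]
  · have := key ⟨‖y‖⁻¹ • y, by simp [norm_smul, hy]⟩ ‖y‖
    have hy' : ‖y‖ ≠ 0 := by simpa using hy
    simpa only [PiLp.smul_apply, smul_eq_mul, mul_inv_cancel_left₀ hy'] using this

end Polynomials

/-- each fiber is a spherical 4-design on its sphere. -/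
theorem statement6
    {X₁ X₂ : Finset (EuclideanSpace ℝ (Fin 22))} {w : EuclideanSpace ℝ (Fin 22) → ℝ}
    {r₁ r₂ : ℝ} (hr₁ : 0 < r₁) (hr₂ : 0 < r₂) (hrne : r₁ ≠ r₂)
    (hX₁ : ∀ x ∈ X₁, ‖x‖ = r₁) (hX₂ : ∀ x ∈ X₂, ‖x‖ = r₂)
    (hw : ∀ x ∈ X₁ ∪ X₂, 0 < w x)
    (hcard : (X₁ ∪ X₂).card = 2300) (hcard₁ : X₁.card = 275)
    (hdesign : IsEuclideanDesignTwoSpheres 6 X₁ X₂ w r₁ r₂) :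
    (∀ f : MvPolynomial (Fin 22) ℝ, f.totalDegree ≤ 4 →
        sphereAvg 22 r₁ f = (X₁.card : ℝ)⁻¹ * ∑ x ∈ X₁, eval (x : Fin 22 → ℝ) f) ∧
    (∀ f : MvPolynomial (Fin 22) ℝ, f.totalDegree ≤ 4 →
        sphereAvg 22 r₂ f = (X₂.card : ℝ)⁻¹ * ∑ x ∈ X₂, eval (x : Fin 22 → ℝ) f) := by
  have hdisj : Disjoint X₁ X₂ := Finset.disjoint_left.2 fun x h1 h2 =>
    hrne ((hX₁ x h1).symm.trans (hX₂ x h2))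
  have hcard₂ : X₂.card = 2025 := by
    rw [Finset.card_union_of_disjoint hdisj] at hcard; omega
  have hW₁ : 0 < ∑ x ∈ X₁, w x := Finset.sum_pos
    (fun x hx => hw x (Finset.mem_union_left _ hx)) (Finset.card_pos.1 (by omega))
  have hW₂ : 0 < ∑ x ∈ X₂, w x := Finset.sum_pos
    (fun x hx => hw x (Finset.mem_union_right _ hx)) (Finset.card_pos.1 (by omega))
  have hsq : ∀ (f : MvPolynomial (Fin 22) ℝ) (x : Fin 22 → ℝ), 0 ≤ eval x (f ^ 2) :=
    fun f x => by rw [map_pow]; positivity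
  have hsqdeg : ∀ f : MvPolynomial (Fin 22) ℝ, f.totalDegree ≤ 3 → (f ^ 2).totalDegree ≤ 6 :=
    fun f hf => (totalDegree_pow _ _).trans (by omega)
  have hinj : ∀ f : MvPolynomial (Fin 22) ℝ, f.totalDegree ≤ 3 →
      (∀ x ∈ X₁ ∪ X₂, eval (x : Fin 22 → ℝ) f = 0) → f = 0 := by
    intro f hf h0
    have hd := hdesign (f ^ 2) (hsqdeg f hf)
    rw [Finset.sum_eq_zero (s := X₁ ∪ X₂) fun x hx => by rw [map_pow, h0 x hx]; simp] at hd
    have h1 := sphereAvg_nonneg r₁ (hsq f)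
    have h2 := sphereAvg_nonneg r₂ (hsq f)
    have h1' : sphereAvg 22 r₁ (f ^ 2) = 0 := by
      refine le_antisymm (le_of_mul_le_mul_left ?_ hW₁) h1
      nlinarith [mul_nonneg hW₂.le h2]
    have h2' : sphereAvg 22 r₂ (f ^ 2) = 0 := by
      refine le_antisymm (le_of_mul_le_mul_left ?_ hW₂) h2
      nlinarith [mul_nonneg hW₁.le h1]
    refine eq_zero_of_eval_two_spheres hr₁ hr₂ hrne hf (by norm_num) (fun u => ?_) fun u => ?_
    · simpa using eval_eq_zero_of_sphereAvg_eq_zero r₁ (hsq f) h1' u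
    · simpa using eval_eq_zero_of_sphereAvg_eq_zero r₂ (hsq f) h2' u
  have hlag := exists_lagrange (k := 3)
    (by rw [hcard]; simp [Finset.sum_range_succ, Nat.choose]) hinj
  have hwle : ∀ x ∈ X₁ ∪ X₂, ∀ y ∈ X₁ ∪ X₂, ‖x‖ = ‖y‖ → w y ≤ w x := by
    intro x hx y hy hxy
    obtain ⟨f, hf, hfx⟩ := hlag x
    let R := (ℝ ∙ (y - x))ᗮ.reflection
    have hRy : R y = x := Submodule.reflection_sub hxy.symm
    obtain ⟨g, hg, hgf⟩ := exists_eval_comp_linear (R.toLinearEquiv : _ →ₗ[ℝ] _) f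
    have hgf2 : ∀ z : EuclideanSpace ℝ (Fin 22),
        eval (z : Fin 22 → ℝ) (g ^ 2) = eval (R z : Fin 22 → ℝ) (f ^ 2) := fun z => by
      rw [map_pow, map_pow, hgf]; rfl
    have hdf := hdesign (f ^ 2) (hsqdeg f hf)
    have hdg := hdesign (g ^ 2) (hsqdeg g (hg.trans hf))
    rw [sphereAvg_congr_isometry r₁ R hgf2, sphereAvg_congr_isometry r₂ R hgf2, hdf] at hdg
    have hfsum : ∑ z ∈ X₁ ∪ X₂, w z * eval (z : Fin 22 → ℝ) (f ^ 2) = w x := by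
      rw [Finset.sum_eq_single_of_mem x hx fun z hz hzx => by simp [hfx z hz, hzx]]
      simp [hfx x hx]
    have hgsum := Finset.single_le_sum
      (f := fun z : EuclideanSpace ℝ (Fin 22) => w z * eval (z : Fin 22 → ℝ) (g ^ 2))
      (fun z hz => mul_nonneg (hw z hz).le (hsq g z)) hy
    simp only [hgf2 y, hRy] at hgsum
    rw [← hdg, hfsum, map_pow, hfx x hx] at hgsum
    simpa using hgsum
  have hweighted : ∀ f : MvPolynomial (Fin 22) ℝ, f.totalDegree ≤ 4 →
      (∑ x ∈ X₁, w x) * sphereAvg 22 r₁ f = ∑ x ∈ X₁, w x * eval (x : Fin 22 → ℝ) f ∧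
      (∑ x ∈ X₂, w x) * sphereAvg 22 r₂ f = ∑ x ∈ X₂, w x * eval (x : Fin 22 → ℝ) f := by
    intro f hf
    let q : MvPolynomial (Fin 22) ℝ := ∑ i, X i ^ 2
    have hq : ∀ x : EuclideanSpace ℝ (Fin 22), eval (x : Fin 22 → ℝ) (q * f) =
        ‖x‖ ^ 2 * eval (x : Fin 22 → ℝ) f := fun x => by
      simp [q, EuclideanSpace.norm_sq_eq]
    have hqdeg : (q * f).totalDegree ≤ 6 := by
      have : q.totalDegree ≤ 2 := totalDegree_finsetSum_le fun i _ => by simp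
      exact (totalDegree_mul _ _).trans (by omega)
    have hd := hdesign f (by omega)
    have hdq := hdesign (q * f) hqdeg
    rw [sphereAvg_eq_mul r₁ (r₁ ^ 2) (f := f) fun x hx => by rw [hq, hx, sq_abs],
      sphereAvg_eq_mul r₂ (r₂ ^ 2) (f := f) fun x hx => by rw [hq, hx, sq_abs],
      Finset.sum_union hdisj] at hdq
    rw [Finset.sum_union hdisj] at hd
    have e₁ : ∑ x ∈ X₁, w x * eval (x : Fin 22 → ℝ) (q * f) =
        r₁ ^ 2 * ∑ x ∈ X₁, w x * eval (x : Fin 22 → ℝ) f := by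
      rw [Finset.mul_sum]
      exact Finset.sum_congr rfl fun x hx => by rw [hq, hX₁ x hx]; ring
    have e₂ : ∑ x ∈ X₂, w x * eval (x : Fin 22 → ℝ) (q * f) =
        r₂ ^ 2 * ∑ x ∈ X₂, w x * eval (x : Fin 22 → ℝ) f := by
      rw [Finset.mul_sum]
      exact Finset.sum_congr rfl fun x hx => by rw [hq, hX₂ x hx]; ring
    rw [e₁, e₂] at hdq
    have hr : r₁ ^ 2 - r₂ ^ 2 ≠ 0 := by
      rw [sq_sub_sq]
      exact mul_ne_zero (by positivity) (sub_ne_zero.2 hrne)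
    constructor <;> refine mul_left_cancel₀ hr ?_
    · linear_combination hdq - r₂ ^ 2 * hd
    · linear_combination r₁ ^ 2 * hd - hdq
  have hunweight : ∀ (Y : Finset (EuclideanSpace ℝ (Fin 22))) (r : ℝ), Y ⊆ X₁ ∪ X₂ →
      (∀ x ∈ Y, ‖x‖ = r) → 0 < Y.card → ∀ f : MvPolynomial (Fin 22) ℝ,
      (∑ x ∈ Y, w x) * sphereAvg 22 r f = ∑ x ∈ Y, w x * eval (x : Fin 22 → ℝ) f →
      sphereAvg 22 r f = (Y.card : ℝ)⁻¹ * ∑ x ∈ Y, eval (x : Fin 22 → ℝ) f := by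
    intro Y r hY hYr hpos f h
    obtain ⟨z, hz⟩ := Finset.card_pos.1 hpos
    have hwz : ∀ x ∈ Y, w x = w z := fun x hx => le_antisymm
      (hwle z (hY hz) x (hY hx) ((hYr z hz).trans (hYr x hx).symm))
      (hwle x (hY hx) z (hY hz) ((hYr x hx).trans (hYr z hz).symm))
    have hsum : ∑ x ∈ Y, w x * eval (x : Fin 22 → ℝ) f =
        w z * ∑ x ∈ Y, eval (x : Fin 22 → ℝ) f := by
      rw [Finset.mul_sum]
      exact Finset.sum_congr rfl fun x hx => by rw [hwz x hx]
    rw [hsum, Finset.sum_congr rfl hwz, Finset.sum_const, nsmul_eq_mul] at h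
    have hz0 : w z ≠ 0 := (hw z (hY hz)).ne'
    have hY0 : (Y.card : ℝ) ≠ 0 := by exact_mod_cast hpos.ne'
    rw [eq_inv_mul_iff_mul_eq₀ hY0]
    refine mul_left_cancel₀ hz0 ?_
    linear_combination h
  exact ⟨fun f hf => hunweight X₁ r₁ Finset.subset_union_left hX₁ (by omega) f (hweighted f hf).1,
    fun f hf => hunweight X₂ r₂ Finset.subset_union_right hX₂ (by omega) f (hweighted f hf).2⟩
end

section
/- Let (X,w) be a Euclidean 6-design in ℝ^22 supported by exactly two concentric spheres of positive radii r1, r2 centered at the origin, with fibers X1 and X2, |X| = 2300 and |X1| = 275. Then for every x ∈ X1, the number of y ∈ X1 with x·y = r1²/6 equals 162, and the number of y ∈ X1 with x·y = −r1²/4 equals 112. -/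
open MeasureTheory Metric MvPolynomial
open scoped RealInnerProductSpace Classical

/-- The action of a linear isometry on the unit sphere. -/
def unitSphereMap {E : Type*} [NormedAddCommGroup E] [InnerProductSpace ℝ E]
    (e : E ≃ₗᵢ[ℝ] E) (u : sphere (0 : E) 1) : sphere (0 : E) 1 :=
  ⟨e u, by simp⟩

theorem continuous_unitSphereMap {E : Type*} [NormedAddCommGroup E] [InnerProductSpace ℝ E]
    (e : E ≃ₗᵢ[ℝ] E) : Continuous (unitSphereMap e) :=
  (e.continuous.comp continuous_subtype_val).subtype_mk _

section SphereMoments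

variable {E : Type*} [NormedAddCommGroup E] [InnerProductSpace ℝ E] [FiniteDimensional ℝ E]
  [MeasurableSpace E] [BorelSpace E]

open scoped Pointwise in
theorem map_unitSphereMap_toSphere (e : E ≃ₗᵢ[ℝ] E) :
    ((volume : Measure E).toSphere).map (unitSphereMap e) = (volume : Measure E).toSphere := by
  ext s hs
  have hm := (continuous_unitSphereMap e).measurable
  rw [Measure.map_apply hm hs, Measure.toSphere_apply' _ (hm hs), Measure.toSphere_apply' _ hs,
    ← MeasurePreserving.measure_preimage_equiv (f := e.toMeasurableEquiv) e.measurePreserving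
      (Set.Ioo (0 : ℝ) 1 • (Subtype.val '' s))]
  congr 2
  ext y
  simp only [Set.mem_smul, Set.mem_image, Set.mem_preimage]
  constructor
  · rintro ⟨c, hc, _, ⟨u, hu, rfl⟩, rfl⟩
    exact ⟨c, hc, _, ⟨_, hu, rfl⟩, by simp [unitSphereMap]⟩
  · rintro ⟨c, hc, _, ⟨u, hu, rfl⟩, h⟩
    refine ⟨c, hc, _, ⟨unitSphereMap e.symm u, ?_, rfl⟩, ?_⟩
    · simpa [unitSphereMap] using hu
    · apply e.injective
      rw [← LinearIsometryEquiv.coe_toMeasurableEquiv, ← h]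
      simp [unitSphereMap]

/-- The average of a function over the unit sphere. -/
noncomputable def unitSphereAvg (F : E → ℝ) : ℝ :=
  ⨍ u : sphere (0 : E) 1, F u ∂((volume : Measure E).toSphere)

theorem unitSphereAvg_comp (e : E ≃ₗᵢ[ℝ] E) {F : E → ℝ} (hF : Continuous F) :
    unitSphereAvg (fun u => F (e u)) = unitSphereAvg F := by
  unfold unitSphereAvg
  rw [average_eq, average_eq]
  congr 1
  have h := integral_map (μ := (volume : Measure E).toSphere)
    (continuous_unitSphereMap e).aemeasurable (f := fun u : sphere (0 : E) 1 => F u)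
    (hF.comp continuous_subtype_val).aestronglyMeasurable
  rw [map_unitSphereMap_toSphere] at h
  exact h.symm

theorem integrable_toSphere {F : E → ℝ} (hF : Continuous F) :
    Integrable (fun u : sphere (0 : E) 1 => F u) (volume : Measure E).toSphere :=
  (hF.comp continuous_subtype_val).integrable_of_hasCompactSupport
    (HasCompactSupport.of_compactSpace _)

theorem unitSphereAvg_add {F G : E → ℝ} (hF : Continuous F) (hG : Continuous G) :
    unitSphereAvg (fun u => F u + G u) = unitSphereAvg F + unitSphereAvg G := by
  simp only [unitSphereAvg, average_eq]
  rw [integral_add (integrable_toSphere hF) (integrable_toSphere hG), smul_add]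

theorem unitSphereAvg_const_mul (c : ℝ) (F : E → ℝ) :
    unitSphereAvg (fun u => c * F u) = c * unitSphereAvg F := by
  simp only [unitSphereAvg, average_eq, integral_const_mul, smul_eq_mul]
  ring

theorem unitSphereAvg_sum {ι : Type*} (s : Finset ι) {F : ι → E → ℝ}
    (hF : ∀ i, Continuous (F i)) :
    unitSphereAvg (fun u => ∑ i ∈ s, F i u) = ∑ i ∈ s, unitSphereAvg (F i) := by
  simp only [unitSphereAvg, average_eq]
  rw [integral_finsetSum _ fun i _ => integrable_toSphere (hF i), Finset.smul_sum]

theorem unitSphereAvg_congr {F G : E → ℝ} (h : ∀ u, ‖u‖ = 1 → F u = G u) :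
    unitSphereAvg F = unitSphereAvg G := by
  unfold unitSphereAvg
  congr 1
  ext u
  exact h u (by simp)

theorem unitSphereAvg_const [Nontrivial E] (c : ℝ) : unitSphereAvg (fun _ : E => c) = c := by
  have : NeZero (volume : Measure E).toSphere := ⟨Measure.toSphere_ne_zero _⟩
  exact average_const _ c

theorem unitSphereAvg_eq_zero_of_odd {F : E → ℝ} (hF : Continuous F)
    (hodd : ∀ u, F (-u) = -F u) : unitSphereAvg F = 0 := by
  have h := unitSphereAvg_comp (LinearIsometryEquiv.neg ℝ) hF
  simp only [LinearIsometryEquiv.coe_neg, hodd, ← neg_one_mul (F _)] at h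
  rw [unitSphereAvg_const_mul] at h
  linarith

theorem unitSphereAvg_inner_pow_congr (k : ℕ) {a b : E} (h : ‖a‖ = ‖b‖) :
    unitSphereAvg (fun u => ⟪a, u⟫ ^ k) = unitSphereAvg (fun u => ⟪b, u⟫ ^ k) := by
  have hc : Continuous fun u : E => ⟪b, u⟫ ^ k := by fun_prop
  rw [← unitSphereAvg_comp (ℝ ∙ (a - b))ᗮ.reflection hc]
  congr 1
  ext u
  rw [← LinearIsometryEquiv.inner_map_map (ℝ ∙ (a - b))ᗮ.reflection a u,
    Submodule.reflection_sub h]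

theorem exists_unitSphereAvg_inner_pow (k : ℕ) [Nontrivial E] :
    ∃ c : ℝ, ∀ a : E, unitSphereAvg (fun u => ⟪a, u⟫ ^ k) = c * ‖a‖ ^ k := by
  obtain ⟨e, he⟩ := exists_norm_eq E zero_le_one
  refine ⟨unitSphereAvg fun u => ⟪e, u⟫ ^ k, fun a => ?_⟩
  rw [unitSphereAvg_inner_pow_congr k (b := ‖a‖ • e) (by simp [norm_smul, he])]
  simp only [real_inner_smul_left, mul_pow]
  rw [unitSphereAvg_const_mul, mul_comm]

theorem unitSphereAvg_inner_sq [Nontrivial E] (a : E) :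
    unitSphereAvg (fun u => ⟪a, u⟫ ^ 2) = ‖a‖ ^ 2 / Module.finrank ℝ E := by
  obtain ⟨c, hc⟩ := exists_unitSphereAvg_inner_pow 2 (E := E)
  let b := stdOrthonormalBasis ℝ E
  have h1 : unitSphereAvg (fun u : E => ∑ i, ⟪b i, u⟫ ^ 2) = 1 := by
    rw [unitSphereAvg_congr (G := fun _ => 1), unitSphereAvg_const]
    intro u hu
    rw [b.sum_sq_inner_right, hu, one_pow]
  rw [unitSphereAvg_sum _ fun i => by fun_prop] at h1
  simp [hc] at h1
  have : (Module.finrank ℝ E : ℝ) ≠ 0 := by rintro h; simp [h] at h1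
  rw [hc]
  field_simp
  linear_combination ‖a‖ ^ 2 * h1

theorem unitSphereAvg_inner_mul_inner [Nontrivial E] (a b : E) :
    unitSphereAvg (fun u => ⟪a, u⟫ * ⟪b, u⟫) = ⟪a, b⟫ / Module.finrank ℝ E := by
  have h := unitSphereAvg_inner_sq (a + b)
  have e : (fun u => ⟪a + b, u⟫ ^ 2)
      = fun u => (⟪a, u⟫ ^ 2 + ⟪b, u⟫ ^ 2) + 2 * (⟪a, u⟫ * ⟪b, u⟫) := by
    ext u; rw [inner_add_left]; ring
  rw [e, unitSphereAvg_add (by fun_prop) (by fun_prop), unitSphereAvg_const_mul,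
    unitSphereAvg_add (by fun_prop) (by fun_prop), unitSphereAvg_inner_sq,
    unitSphereAvg_inner_sq, norm_add_sq_real] at h
  linear_combination h / 2

theorem unitSphereAvg_inner_sq_mul_inner_sq [Nontrivial E] (a b : E) :
    unitSphereAvg (fun u => ⟪a, u⟫ ^ 2 * ⟪b, u⟫ ^ 2)
      = (‖a‖ ^ 2 * ‖b‖ ^ 2 + 2 * ⟪a, b⟫ ^ 2)
        / (Module.finrank ℝ E * (Module.finrank ℝ E + 2)) := by
  obtain ⟨c, hc⟩ := exists_unitSphereAvg_inner_pow 4 (E := E)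
  have key (a b : E) : unitSphereAvg (fun u => ⟪a, u⟫ ^ 2 * ⟪b, u⟫ ^ 2)
      = c / 3 * (‖a‖ ^ 2 * ‖b‖ ^ 2 + 2 * ⟪a, b⟫ ^ 2) := by
    have e : unitSphereAvg (fun u => ⟪a + b, u⟫ ^ 4 + ⟪a - b, u⟫ ^ 4)
        = unitSphereAvg fun u => (2 * ⟪a, u⟫ ^ 4 + 2 * ⟪b, u⟫ ^ 4)
          + 12 * (⟪a, u⟫ ^ 2 * ⟪b, u⟫ ^ 2) := by
      congr 1; ext u; rw [inner_add_left, inner_sub_left]; ring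
    rw [unitSphereAvg_add (by fun_prop) (by fun_prop),
      unitSphereAvg_add (by fun_prop) (by fun_prop),
      unitSphereAvg_add (by fun_prop) (by fun_prop), unitSphereAvg_const_mul,
      unitSphereAvg_const_mul, unitSphereAvg_const_mul, hc, hc, hc, hc] at e
    have hp (v : E) : ‖v‖ ^ 4 = (‖v‖ ^ 2) ^ 2 := by ring
    rw [hp (a + b), hp (a - b), norm_add_sq_real, norm_sub_sq_real] at e
    linear_combination -e / 12
  have hn : (0 : ℝ) < Module.finrank ℝ E := by exact_mod_cast Module.finrank_pos
  obtain ⟨v, hv⟩ := exists_norm_eq E zero_le_one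
  let o := stdOrthonormalBasis ℝ E
  have h1 : unitSphereAvg (fun u : E => ∑ i, ⟪v, u⟫ ^ 2 * ⟪o i, u⟫ ^ 2)
      = unitSphereAvg fun u : E => ⟪v, u⟫ ^ 2 := by
    apply unitSphereAvg_congr
    intro u hu
    rw [← Finset.mul_sum, o.sum_sq_inner_right, hu, one_pow, mul_one]
  rw [unitSphereAvg_sum _ fun i => by fun_prop, unitSphereAvg_inner_sq] at h1
  simp only [key, ← Finset.mul_sum, Finset.sum_add_distrib, o.sum_sq_inner_left, hv] at h1
  simp at h1
  rw [key]
  field_simp at h1 ⊢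
  linear_combination (‖a‖ ^ 2 * ‖b‖ ^ 2 + 2 * ⟪a, b⟫ ^ 2) * h1

theorem unitSphereAvg_quadratic_mul_quadratic [Nontrivial E] (p q s : ℝ) {a b : E}
    (ha : ‖a‖ = 1) (hb : ‖b‖ = 1) :
    unitSphereAvg (fun u => (p * ⟪a, u⟫ ^ 2 + q * ⟪a, u⟫ + s)
        * (p * ⟪b, u⟫ ^ 2 + q * ⟪b, u⟫ + s))
      = p ^ 2 * (1 + 2 * ⟪a, b⟫ ^ 2) / (Module.finrank ℝ E * (Module.finrank ℝ E + 2))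
        + q ^ 2 * ⟪a, b⟫ / Module.finrank ℝ E + 2 * p * s / Module.finrank ℝ E + s ^ 2 := by
  have e : unitSphereAvg (fun u => (p * ⟪a, u⟫ ^ 2 + q * ⟪a, u⟫ + s)
        * (p * ⟪b, u⟫ ^ 2 + q * ⟪b, u⟫ + s))
      = unitSphereAvg fun u => (((p ^ 2 * (⟪a, u⟫ ^ 2 * ⟪b, u⟫ ^ 2)
          + q ^ 2 * (⟪a, u⟫ * ⟪b, u⟫)) + (p * s * ⟪a, u⟫ ^ 2 + p * s * ⟪b, u⟫ ^ 2))
          + s ^ 2) + (p * q * (⟪a, u⟫ ^ 2 * ⟪b, u⟫ + ⟪a, u⟫ * ⟪b, u⟫ ^ 2)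
            + q * s * (⟪a, u⟫ + ⟪b, u⟫)) := by
    congr 1; ext u; ring
  rw [e, unitSphereAvg_add (by fun_prop) (by fun_prop),
    unitSphereAvg_add (by fun_prop) (by fun_prop),
    unitSphereAvg_add (by fun_prop) (by fun_prop),
    unitSphereAvg_add (by fun_prop) (by fun_prop),
    unitSphereAvg_add (by fun_prop) (by fun_prop),
    unitSphereAvg_eq_zero_of_odd
      (F := fun u => p * q * (⟪a, u⟫ ^ 2 * ⟪b, u⟫ + ⟪a, u⟫ * ⟪b, u⟫ ^ 2)
            + q * s * (⟪a, u⟫ + ⟪b, u⟫)) (by fun_prop)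
      (fun u => by simp only [inner_neg_right]; ring),
    unitSphereAvg_const, unitSphereAvg_const_mul, unitSphereAvg_const_mul,
    unitSphereAvg_const_mul, unitSphereAvg_const_mul, unitSphereAvg_inner_sq,
    unitSphereAvg_inner_sq, unitSphereAvg_inner_sq_mul_inner_sq, unitSphereAvg_inner_mul_inner,
    ha, hb]
  ring

end SphereMoments

/-- The linear form `⟪a, ·⟫` as a polynomial. -/
noncomputable def innerPoly {n : ℕ} (a : EuclideanSpace ℝ (Fin n)) : MvPolynomial (Fin n) ℝ :=
  ∑ i, C (a i) * X i

theorem eval_innerPoly {n : ℕ} (a y : EuclideanSpace ℝ (Fin n)) :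
    eval (y : Fin n → ℝ) (innerPoly a) = ⟪a, y⟫ := by
  simp [innerPoly, PiLp.inner_apply, mul_comm]

theorem totalDegree_innerPoly_le {n : ℕ} (a : EuclideanSpace ℝ (Fin n)) :
    (innerPoly a).totalDegree ≤ 1 := by
  refine (totalDegree_finsetSum _ _).trans (Finset.sup_le fun i _ => ?_)
  refine (totalDegree_mul _ _).trans ?_
  simp

theorem sphereAvg_eq_unitSphereAvg {n : ℕ} (r : ℝ) (f : MvPolynomial (Fin n) ℝ) :
    sphereAvg n r f
      = unitSphereAvg fun u : EuclideanSpace ℝ (Fin n) =>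
        eval ((r • u : EuclideanSpace ℝ (Fin n)) : Fin n → ℝ) f := by
  rfl

/-- The polynomial `‖·‖ ^ 2 - r ^ 2`, which vanishes on the sphere of radius `r`. -/
noncomputable def spherePoly (n : ℕ) (r : ℝ) : MvPolynomial (Fin n) ℝ :=
  ∑ i, X i ^ 2 - C (r ^ 2)

theorem eval_spherePoly {n : ℕ} (r : ℝ) (y : EuclideanSpace ℝ (Fin n)) :
    eval (y : Fin n → ℝ) (spherePoly n r) = ‖y‖ ^ 2 - r ^ 2 := by
  simp [spherePoly, EuclideanSpace.real_norm_sq_eq]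

theorem totalDegree_spherePoly_le (n : ℕ) (r : ℝ) : (spherePoly n r).totalDegree ≤ 2 := by
  refine (totalDegree_sub _ _).trans (max_le ?_ (by rw [totalDegree_C]; norm_num))
  exact (totalDegree_finsetSum _ _).trans (Finset.sup_le fun i _ => by simp)

theorem sphereAvg_spherePoly_mul {n : ℕ} {r : ℝ} (hr : 0 ≤ r) (s : ℝ)
    (g : MvPolynomial (Fin n) ℝ) :
    sphereAvg n r (spherePoly n s * g) = (r ^ 2 - s ^ 2) * sphereAvg n r g := by
  rw [sphereAvg_eq_unitSphereAvg, sphereAvg_eq_unitSphereAvg, ← unitSphereAvg_const_mul]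
  refine unitSphereAvg_congr fun u hu => ?_
  rw [map_mul, eval_spherePoly, norm_smul, hu, mul_one, Real.norm_of_nonneg hr]

/-- One sphere of a Euclidean design on two spheres is a weighted spherical design, of strength
smaller by two. -/
theorem IsEuclideanDesignTwoSpheres.fiber {t : ℕ} {X₁ X₂ : Finset (EuclideanSpace ℝ (Fin 22))}
    {w : EuclideanSpace ℝ (Fin 22) → ℝ} {r₁ r₂ : ℝ} (hr₁ : 0 ≤ r₁) (hr₂ : 0 ≤ r₂)
    (hrne : r₁ ≠ r₂) (hX₁ : ∀ x ∈ X₁, ‖x‖ = r₁) (hX₂ : ∀ x ∈ X₂, ‖x‖ = r₂)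
    (hdesign : IsEuclideanDesignTwoSpheres (t + 2) X₁ X₂ w r₁ r₂)
    (g : MvPolynomial (Fin 22) ℝ) (hg : g.totalDegree ≤ t) :
    ∑ x ∈ X₁, w x * eval (x : Fin 22 → ℝ) g = (∑ x ∈ X₁, w x) * sphereAvg 22 r₁ g := by
  have hsq : r₁ ^ 2 - r₂ ^ 2 ≠ 0 := fun h =>
    hrne ((sq_eq_sq₀ hr₁ hr₂).1 (sub_eq_zero.1 h))
  have hdisj : Disjoint X₁ X₂ := Finset.disjoint_left.2 fun x h₁ h₂ =>
    hrne ((hX₁ x h₁).symm.trans (hX₂ x h₂))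
  have h := hdesign (spherePoly 22 r₂ * g) ((totalDegree_mul _ _).trans (by
    have := totalDegree_spherePoly_le 22 r₂
    omega))
  rw [sphereAvg_spherePoly_mul hr₁, sphereAvg_spherePoly_mul hr₂, Finset.sum_union hdisj] at h
  have h₁ : ∑ x ∈ X₁, w x * eval (x : Fin 22 → ℝ) (spherePoly 22 r₂ * g)
      = (r₁ ^ 2 - r₂ ^ 2) * ∑ x ∈ X₁, w x * eval (x : Fin 22 → ℝ) g := by
    rw [Finset.mul_sum]
    refine Finset.sum_congr rfl fun x hx => ?_
    rw [map_mul, eval_spherePoly, hX₁ x hx]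
    ring
  have h₂ : ∑ x ∈ X₂, w x * eval (x : Fin 22 → ℝ) (spherePoly 22 r₂ * g) = 0 :=
    Finset.sum_eq_zero fun x hx => by
      rw [map_mul, eval_spherePoly, hX₂ x hx]
      ring
  rw [h₁, h₂] at h
  apply mul_left_cancel₀ hsq
  linear_combination -h

/-- The reproducing kernel, in terms of the inner product, of the polynomials of degree at most two
on the unit sphere of `ℝ²²`. -/
def quadraticKernel (t : ℝ) : ℝ := 264 * t ^ 2 + 22 * t + -11

/-- The polynomial `y ↦ quadraticKernel (⟪a, y⟫)`. -/
noncomputable def quadraticKernelPoly (a : EuclideanSpace ℝ (Fin 22)) :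
    MvPolynomial (Fin 22) ℝ :=
  C 264 * innerPoly a ^ 2 + C 22 * innerPoly a + C (-11)

theorem eval_quadraticKernelPoly (a y : EuclideanSpace ℝ (Fin 22)) :
    eval (y : Fin 22 → ℝ) (quadraticKernelPoly a) = quadraticKernel ⟪a, y⟫ := by
  simp only [quadraticKernelPoly, map_add, map_mul, map_pow, eval_C, eval_innerPoly,
    quadraticKernel]

theorem totalDegree_quadraticKernelPoly_le (a : EuclideanSpace ℝ (Fin 22)) :
    (quadraticKernelPoly a).totalDegree ≤ 2 := by
  have h := totalDegree_innerPoly_le a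
  refine (totalDegree_add _ _).trans (max_le ((totalDegree_add _ _).trans (max_le ?_ ?_)) ?_)
  · have := totalDegree_pow (innerPoly a) 2
    refine (totalDegree_mul _ _).trans ?_
    rw [totalDegree_C]
    omega
  · refine (totalDegree_mul _ _).trans ?_
    rw [totalDegree_C]
    omega
  · simp

theorem sphereAvg_quadraticKernelPoly_mul {r : ℝ} (hr : 0 < r)
    {x z : EuclideanSpace ℝ (Fin 22)} (hx : ‖x‖ = r) (hz : ‖z‖ = r) :
    sphereAvg 22 r (quadraticKernelPoly ((r ^ 2)⁻¹ • x) * quadraticKernelPoly ((r ^ 2)⁻¹ • z))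
      = quadraticKernel (⟪x, z⟫ / r ^ 2) := by
  have hn {v : EuclideanSpace ℝ (Fin 22)} (hv : ‖v‖ = r) : ‖r⁻¹ • v‖ = 1 := by
    rw [norm_smul, norm_inv, Real.norm_of_nonneg hr.le, hv, inv_mul_cancel₀ hr.ne']
  have hs (v u : EuclideanSpace ℝ (Fin 22)) : ⟪(r ^ 2)⁻¹ • v, r • u⟫ = ⟪r⁻¹ • v, u⟫ := by
    simp only [real_inner_smul_left, real_inner_smul_right]
    field_simp
  rw [sphereAvg_eq_unitSphereAvg]
  simp only [map_mul, eval_quadraticKernelPoly, hs, quadraticKernel]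
  rw [unitSphereAvg_quadratic_mul_quadratic _ _ _ (hn hx) (hn hz), finrank_euclideanSpace_fin,
    real_inner_smul_left, real_inner_smul_right]
  push_cast
  field_simp
  ring

theorem sphereAvg_innerPoly {n : ℕ} (r : ℝ) (a : EuclideanSpace ℝ (Fin n)) :
    sphereAvg n r (innerPoly a) = 0 := by
  rw [sphereAvg_eq_unitSphereAvg]
  simp only [eval_innerPoly]
  exact unitSphereAvg_eq_zero_of_odd (by fun_prop) fun u => by
    rw [smul_neg, inner_neg_right]

/-- A kernel reproducing itself with respect to a positive measure on a finite set, whose diagonal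
value is the size of the set, is diagonal. -/
theorem eq_zero_and_weight_eq_of_reproducing {α : Type*} [DecidableEq α] {s : Finset α}
    {w : α → ℝ} {K : α → α → ℝ}
    (hw : ∀ x ∈ s, 0 < w x) (hdiag : ∀ x ∈ s, K x x = s.card)
    (hK : ∀ x ∈ s, ∑ y ∈ s, w y * (K x y * K x y) = (∑ y ∈ s, w y) * K x x) :
    (∀ x ∈ s, ∀ y ∈ s, x ≠ y → K x y = 0) ∧ ∀ x ∈ s, s.card * w x = ∑ y ∈ s, w y := by
  set W := ∑ y ∈ s, w y with hW
  let D : α → α → ℝ := fun x y => w x * w y * (K x y - if x = y then W / w x else 0) ^ 2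
  have hD0 : ∀ x ∈ s, ∀ y ∈ s, 0 ≤ D x y := fun x hx y hy =>
    mul_nonneg (mul_pos (hw x hx) (hw y hy)).le (sq_nonneg _)
  have hrow : ∀ x ∈ s, ∑ y ∈ s, D x y = w x * W * s.card - 2 * W * w x * s.card + W ^ 2 := by
    intro x hx
    have hwx := (hw x hx).ne'
    have e : ∀ y ∈ s, D x y = w x * (w y * (K x y * K x y))
        + if x = y then -2 * W * w x * K x x + W ^ 2 else 0 := by
      intro y _
      by_cases h : x = y
      · subst h
        simp only [D, if_true]
        field_simp
        ring
      · simp only [D, if_neg h]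
        ring
    rw [Finset.sum_congr rfl e, Finset.sum_add_distrib, ← Finset.mul_sum, hK x hx,
      Finset.sum_ite_eq, if_pos hx, hdiag x hx]
    ring
  have htot : ∑ x ∈ s, ∑ y ∈ s, D x y = 0 := by
    rw [Finset.sum_congr rfl hrow, Finset.sum_add_distrib, Finset.sum_sub_distrib,
      ← Finset.sum_mul, ← Finset.sum_mul, ← Finset.sum_mul, ← Finset.mul_sum, ← hW,
      Finset.sum_const, nsmul_eq_mul]
    ring
  have hD : ∀ x ∈ s, ∀ y ∈ s, K x y = if x = y then W / w x else 0 := by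
    intro x hx y hy
    have h := (Finset.sum_eq_zero_iff_of_nonneg (hD0 x hx)).1
      ((Finset.sum_eq_zero_iff_of_nonneg fun x hx => Finset.sum_nonneg (hD0 x hx)).1 htot x hx) y hy
    simpa [D, (hw x hx).ne', (hw y hy).ne', sub_eq_zero] using h
  refine ⟨fun x hx y hy h => by rw [hD x hx y hy, if_neg h], fun x hx => ?_⟩
  rw [← hdiag x hx, hD x hx x hx, if_pos rfl, div_mul_cancel₀ _ (hw x hx).ne']

/-- intersection numbers within `X₁`: each point of `X₁` has inner product
`r₁²/6` with exactly 162 points of `X₁` and `-r₁²/4` with exactly 112 points of `X₁`. -/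
theorem statement7
    {X₁ X₂ : Finset (EuclideanSpace ℝ (Fin 22))} {w : EuclideanSpace ℝ (Fin 22) → ℝ}
    {r₁ r₂ : ℝ} (hr₁ : 0 < r₁) (hr₂ : 0 < r₂) (hrne : r₁ ≠ r₂)
    (hX₁ : ∀ x ∈ X₁, ‖x‖ = r₁) (hX₂ : ∀ x ∈ X₂, ‖x‖ = r₂)
    (hw : ∀ x ∈ X₁ ∪ X₂, 0 < w x)
    (hcard : (X₁ ∪ X₂).card = 2300) (hcard₁ : X₁.card = 275)
    (hdesign : IsEuclideanDesignTwoSpheres 6 X₁ X₂ w r₁ r₂) :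
    ∀ x ∈ X₁,
      (X₁.filter fun y => ⟪x, y⟫ = r₁ ^ 2 / 6).card = 162 ∧
      (X₁.filter fun y => ⟪x, y⟫ = -(r₁ ^ 2 / 4)).card = 112 := by
  intro x hx
  set s := r₁ ^ 2
  have hs0 : 0 < s := by positivity
  have hself {z : EuclideanSpace ℝ (Fin 22)} (hz : z ∈ X₁) : ⟪z, z⟫ = s := by
    rw [real_inner_self_eq_norm_sq, hX₁ z hz]
  have hw₁ : ∀ z ∈ X₁, 0 < w z := fun z hz => hw z (Finset.mem_union_left _ hz)
  have hfib := hdesign.fiber hr₁.le hr₂.le hrne hX₁ hX₂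
  obtain ⟨hoff, hconst⟩ := eq_zero_and_weight_eq_of_reproducing
    (K := fun y z => quadraticKernel (⟪y, z⟫ / s)) hw₁
    (fun y hy => by
      simp only [hself hy, div_self hs0.ne', hcard₁, quadraticKernel]
      norm_num)
    (fun y hy => by
      have h := hfib (quadraticKernelPoly (s⁻¹ • y) * quadraticKernelPoly (s⁻¹ • y))
        ((totalDegree_mul _ _).trans (by
          have := totalDegree_quadraticKernelPoly_le (s⁻¹ • y)
          omega))
      rw [sphereAvg_quadraticKernelPoly_mul hr₁ (hX₁ y hy) (hX₁ y hy)] at h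
      rw [← h]
      simp only [map_mul, eval_quadraticKernelPoly, real_inner_smul_left, div_eq_inv_mul])
  set A := X₁.filter fun y => ⟪x, y⟫ = s / 6
  set B := X₁.filter fun y => ⟪x, y⟫ = -(s / 4)
  have hcover : ∀ y ∈ X₁, y ≠ x → ⟪x, y⟫ = s / 6 ∨ ⟪x, y⟫ = -(s / 4) := by
    intro y hy hne
    have h : quadraticKernel (⟪x, y⟫ / s) = 0 := hoff x hx y hy hne.symm
    have h' : (⟪x, y⟫ / s - 1 / 6) * (⟪x, y⟫ / s + 1 / 4) = 0 := by
      unfold quadraticKernel at h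
      linear_combination h / 264
    refine (mul_eq_zero.1 h').imp (fun h => ?_) fun h => ?_
    · field_simp at h ⊢
      linarith
    · field_simp at h ⊢
      linarith
  have hterm (F : ℝ → ℝ) (y) (hy : y ∈ X₁) : F ⟪x, y⟫
      = (if y = x then F s else 0) + (if ⟪x, y⟫ = s / 6 then F (s / 6) else 0)
        + if ⟪x, y⟫ = -(s / 4) then F (-(s / 4)) else 0 := by
    have h1 : s ≠ s / 6 := by intro h; linarith
    have h2 : s ≠ -(s / 4) := by intro h; linarith
    have h3 : s / 6 ≠ -(s / 4) := by intro h; linarith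
    by_cases hyx : y = x
    · subst hyx
      rw [hself hy, if_pos rfl, if_neg h1, if_neg h2, add_zero, add_zero]
    · rcases hcover y hy hyx with h | h
      · simp [hyx, h, h3]
      · simp [hyx, h, h3.symm]
  have hsum (F : ℝ → ℝ) : ∑ y ∈ X₁, F ⟪x, y⟫
      = F s + A.card * F (s / 6) + B.card * F (-(s / 4)) := by
    rw [Finset.sum_congr rfl (hterm F), Finset.sum_add_distrib, Finset.sum_add_distrib,
      Finset.sum_ite_eq', if_pos hx, ← Finset.sum_filter, ← Finset.sum_filter, Finset.sum_const,
      Finset.sum_const, nsmul_eq_mul, nsmul_eq_mul]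
  have h0 := hsum fun _ => 1
  have h1 := hsum fun t => t
  have hzero : ∑ y ∈ X₁, ⟪x, y⟫ = 0 := by
    have h := hfib (innerPoly x) ((totalDegree_innerPoly_le x).trans (by norm_num))
    rw [sphereAvg_innerPoly, mul_zero] at h
    simp only [eval_innerPoly] at h
    rw [← mul_right_inj' (hw₁ x hx).ne', mul_zero, Finset.mul_sum, ← h]
    refine Finset.sum_congr rfl fun y hy => ?_
    have : (X₁.card : ℝ) * w x = X₁.card * w y := (hconst x hx).trans (hconst y hy).symm
    rw [mul_left_cancel₀ (by rw [hcard₁]; norm_num) this]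
  rw [hzero] at h1
  simp only [Finset.sum_const, hcard₁, nsmul_eq_mul] at h0
  push_cast at h0
  have h1' : 1 + (A.card : ℝ) / 6 - B.card / 4 = 0 := by
    apply mul_left_cancel₀ hs0.ne'
    linear_combination -h1
  constructor
  · have : (A.card : ℝ) = 162 := by linarith
    exact_mod_cast this
  · have : (B.card : ℝ) = 112 := by linarith
    exact_mod_cast this
end

section
/- Let (X,w) be a Euclidean 6-design in ℝ^22 supported by exactly two concentric spheres of positive radii r1, r2 centered at the origin, with fibers X1 and X2, |X| = 2300 and |X1| = 275. Then for every x ∈ X1, the number of y ∈ X2 with x·y = r1r2/√11 equals 567, the number with x·y = −r1r2/(4√11) equals 1296, and the number with x·y = −3r1r2/(2√11) equals 162. -/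
open MeasureTheory Metric MvPolynomial
open scoped RealInnerProductSpace Classical

section SphereMoments

variable {E : Type*} [NormedAddCommGroup E] [InnerProductSpace ℝ E]

/-- The action of a linear isometry on the unit sphere. -/
def sphereIsometry (T : E ≃ₗᵢ[ℝ] E) (u : sphere (0 : E) 1) : sphere (0 : E) 1 :=
  ⟨T u, by simp⟩

lemma continuous_sphereIsometry (T : E ≃ₗᵢ[ℝ] E) : Continuous (sphereIsometry T) :=
  (T.continuous.comp continuous_subtype_val).subtype_mk _

variable [FiniteDimensional ℝ E] [MeasurableSpace E] [BorelSpace E]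

open scoped Pointwise in
lemma measurePreserving_sphereIsometry (T : E ≃ₗᵢ[ℝ] E) :
    MeasurePreserving (sphereIsometry T) (volume : Measure E).toSphere
      (volume : Measure E).toSphere := by
  refine ⟨(continuous_sphereIsometry T).measurable, ?_⟩
  ext s hs
  have hm := (continuous_sphereIsometry T).measurable
  rw [Measure.map_apply hm hs, Measure.toSphere_apply' _ hs, Measure.toSphere_apply' _ (hm hs)]
  congr 1
  have h : (Set.Ioo (0 : ℝ) 1 • ((↑) '' (sphereIsometry T ⁻¹' s) : Set E))
      = T ⁻¹' (Set.Ioo (0 : ℝ) 1 • ((↑) '' s : Set E)) := by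
    ext y
    simp only [Set.mem_smul, Set.mem_preimage, Set.mem_image]
    constructor
    · rintro ⟨a, ha, _, ⟨u, hu, rfl⟩, rfl⟩
      exact ⟨a, ha, _, ⟨_, hu, rfl⟩, by simp [sphereIsometry]⟩
    · rintro ⟨a, ha, _, ⟨u, hu, rfl⟩, h⟩
      refine ⟨a, ha, T.symm u, ⟨⟨T.symm u, by simp⟩, ?_, rfl⟩, ?_⟩
      · simpa [sphereIsometry] using hu
      · apply T.injective
        simpa using h
  rw [h]
  exact MeasurePreserving.measure_preimage_equiv (f := T.toMeasurableEquiv) T.measurePreserving _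

lemma average_sphereIsometry (T : E ≃ₗᵢ[ℝ] E) {f : sphere (0 : E) 1 → ℝ} (hf : Continuous f) :
    ⨍ u, f (sphereIsometry T u) ∂(volume : Measure E).toSphere
      = ⨍ u, f u ∂(volume : Measure E).toSphere := by
  have h := measurePreserving_sphereIsometry T
  rw [average_eq, average_eq]
  congr 1
  rw [← integral_map (φ := sphereIsometry T) h.measurable.aemeasurable
    (by exact hf.aestronglyMeasurable), h.map_eq]

/-- The `k`-th moment of the linear form `⟪x, ·⟫` over the unit sphere. -/
noncomputable def sphereMoment (k : ℕ) (x : E) : ℝ :=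
  ⨍ u : sphere (0 : E) 1, ⟪x, (u : E)⟫ ^ k ∂(volume : Measure E).toSphere

lemma sphereMoment_smul (k : ℕ) (a : ℝ) (x : E) :
    sphereMoment k (a • x) = a ^ k * sphereMoment k x := by
  simp only [sphereMoment, real_inner_smul_left, mul_pow, average_eq, integral_const_mul,
    smul_eq_mul]
  ring

lemma sphereMoment_congr_norm (k : ℕ) {x y : E} (h : ‖x‖ = ‖y‖) :
    sphereMoment k x = sphereMoment k y := by
  set T := (ℝ ∙ (x - y))ᗮ.reflection
  have hT : T y = x := by
    rw [← Submodule.reflection_sub h, Submodule.reflection_reflection]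
  rw [sphereMoment, ← average_sphereIsometry T (by fun_prop)]
  have h' : ∀ u : sphere (0 : E) 1, ⟪x, (sphereIsometry T u : E)⟫ = ⟪y, (u : E)⟫ := fun u ↦ by
    rw [← hT]
    exact T.inner_map_map _ _
  simp only [h', sphereMoment]

lemma sphereMoment_eq (k : ℕ) {e : E} (he : ‖e‖ = 1) (x : E) :
    sphereMoment k x = ‖x‖ ^ k * sphereMoment k e := by
  rw [← sphereMoment_smul]
  exact sphereMoment_congr_norm k (by simp [norm_smul, he])

lemma sphereMoment_eq_zero {k : ℕ} (hk : Odd k) (x : E) : sphereMoment k x = 0 := by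
  have h1 := sphereMoment_congr_norm k (norm_neg x)
  have h2 := sphereMoment_smul k (-1) x
  rw [hk.neg_one_pow, neg_one_smul] at h2
  linarith

lemma integrable_inner_pow (k : ℕ) (x : E) :
    Integrable (fun u : sphere (0 : E) 1 ↦ ⟪x, (u : E)⟫ ^ k)
      (((volume : Measure E).toSphere Set.univ)⁻¹ • (volume : Measure E).toSphere) := by
  refine Integrable.to_average ?_
  exact Continuous.integrable_of_hasCompactSupport (by fun_prop)
    (HasCompactSupport.of_compactSpace _)

lemma sphereMoment_zero [Nontrivial E] (x : E) : sphereMoment 0 x = 1 := by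
  have : NeZero (volume : Measure E).toSphere := ⟨Measure.toSphere_ne_zero _⟩
  simp [sphereMoment, average_const]

variable {ι τ : Type*} [Fintype ι] [Fintype τ]

lemma sum_sphereMoment_two [Nontrivial E] (b : OrthonormalBasis ι ℝ E) :
    ∑ i, sphereMoment 2 (b i) = 1 := by
  rw [← sphereMoment_zero (0 : E)]
  simp only [sphereMoment, average]
  rw [← integral_finsetSum _ fun i _ ↦ integrable_inner_pow 2 (b i)]
  congr 1 with u
  rw [b.sum_sq_inner_right]
  simp

/-- Multiplying `⟪b j, ·⟫ ^ m` by `∑ i, ⟪b i, ·⟫ ^ 2 = 1` and polarizing relates moments of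
different orders. -/
lemma sphereMoment_eq_sum (b : OrthonormalBasis ι ℝ E) (j : ι) {m k : ℕ} {a p q : τ → ℝ}
    (h : ∀ x y : ℝ, x ^ m * y ^ 2 = ∑ t, a t * (p t * x + q t * y) ^ k) :
    sphereMoment m (b j) = ∑ i, ∑ t, a t * sphereMoment k (p t • b j + q t • b i) := by
  simp only [sphereMoment, average, ← integral_const_mul]
  have hi := fun x c ↦ (integrable_inner_pow (E := E) k x).const_mul c
  rw [Finset.sum_congr rfl fun i _ ↦ (integral_finsetSum _ fun t _ ↦ hi _ _).symm,
    ← integral_finsetSum _ fun i _ ↦ integrable_finsetSum _ fun t _ ↦ hi _ _]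
  congr 1 with u
  have hu : ∑ i, ⟪b i, (u : E)⟫ ^ 2 = 1 := by
    rw [b.sum_sq_inner_right]
    simp
  simp only [inner_add_left, real_inner_smul_left, ← h]
  rw [← Finset.mul_sum, hu, mul_one]

end SphereMoments

/-- The second, fourth and sixth moments of a linear form over the unit sphere of `ℝ²²`. -/
lemma sphereMoment_values (x : EuclideanSpace ℝ (Fin 22)) :
    sphereMoment 2 x = ‖x‖ ^ 2 / 22 ∧ sphereMoment 4 x = ‖x‖ ^ 4 / 176 ∧
      sphereMoment 6 x = ‖x‖ ^ 6 * 5 / 4576 := by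
  set b := EuclideanSpace.basisFun (Fin 22) ℝ
  have hb : ∀ i, ‖b i‖ = 1 := b.orthonormal.1
  have key := fun k y ↦ sphereMoment_eq k (hb 0) y
  have hn : ∀ p q : ℝ, ∀ i : Fin 21, ‖p • b 0 + q • b i.succ‖ ^ 2 = p ^ 2 + q ^ 2 :=
    fun p q i ↦ by
      have h0 : ⟪b 0, b i.succ⟫ = 0 := b.orthonormal.2 (Fin.succ_ne_zero i).symm
      rw [norm_add_sq_real, norm_smul, norm_smul, inner_smul_right, real_inner_smul_left, h0, hb,
        hb]
      simp
  have hp : ∀ (k : ℕ) (p q : ℝ), ∀ i : Fin 21, sphereMoment (2 * k) (p • b 0 + q • b i.succ)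
      = (p ^ 2 + q ^ 2) ^ k * sphereMoment (2 * k) (b 0) :=
    fun k p q i ↦ by rw [key, pow_mul, hn]
  have hd : ∀ (k : ℕ) (p q : ℝ), sphereMoment k (p • b 0 + q • b 0)
      = (p + q) ^ k * sphereMoment k (b 0) := fun k p q ↦ by
    rw [← add_smul, sphereMoment_smul]
  have h2 := sum_sphereMoment_two b
  have h4 := sphereMoment_eq_sum b 0 (m := 2) (k := 2 * 2) (a := ![1 / 12, 1 / 12, -1 / 6, -1 / 6])
    (p := ![1, 1, 1, 0]) (q := ![1, -1, 0, 1]) fun x y ↦ by simp [Fin.sum_univ_four]; ring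
  have h6 := sphereMoment_eq_sum b 0 (m := 4) (k := 2 * 3)
    (a := ![16 / 360, 16 / 360, -1 / 360, -1 / 360, -30 / 360, 96 / 360])
    (p := ![1, 1, 1, 1, 1, 0]) (q := ![1, -1, 2, -2, 0, 1])
    fun x y ↦ by simp [Fin.sum_univ_six]; ring
  rw [Finset.sum_congr rfl fun i _ ↦ key 2 (b i)] at h2
  simp only [hb, one_pow, one_mul, Finset.sum_const, Finset.card_univ, Fintype.card_fin,
    nsmul_eq_mul] at h2
  rw [Fin.sum_univ_succ] at h4 h6
  simp only [hd, hp, Finset.sum_const, Finset.card_univ, Fintype.card_fin, nsmul_eq_mul] at h4 h6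
  simp [Fin.sum_univ_four] at h4
  simp [Fin.sum_univ_six] at h6
  rw [key 2, key 4, key 6]
  have e2 : sphereMoment 2 (b 0) = 1 / 22 := by norm_num at h2; linarith
  have e4 : sphereMoment 4 (b 0) = 1 / 176 := by norm_num at h4; linarith
  have e6 : sphereMoment 6 (b 0) = 5 / 4576 := by norm_num at h6; linarith
  rw [e2, e4, e6]
  refine ⟨?_, ?_, ?_⟩ <;> ring

section Design

variable {X₁ X₂ : Finset (EuclideanSpace ℝ (Fin 22))} {w : EuclideanSpace ℝ (Fin 22) → ℝ}
  {r₁ r₂ : ℝ}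

/-- `⟪x, z⟫ ^ j * ‖z‖ ^ (2 * k)` is a polynomial in `z` of degree at most `j + 2 * k`. -/
lemma exists_polynomial_inner_norm {n : ℕ} (x : EuclideanSpace ℝ (Fin n)) (j k : ℕ) :
    ∃ f : MvPolynomial (Fin n) ℝ, f.totalDegree ≤ j + 2 * k ∧
      ∀ z : EuclideanSpace ℝ (Fin n), eval (z : Fin n → ℝ) f = ⟪x, z⟫ ^ j * (‖z‖ ^ 2) ^ k := by
  refine ⟨(∑ i, C (x i) * X i) ^ j * (∑ i, X i ^ 2) ^ k, ?_, fun z ↦ ?_⟩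
  · have h1 : (∑ i, C (x i) * X i : MvPolynomial (Fin n) ℝ).totalDegree ≤ 1 :=
      (totalDegree_finsetSum _ _).trans <| Finset.sup_le fun i _ ↦
        (totalDegree_mul _ _).trans (by simp)
    have h2 : (∑ i, X i ^ 2 : MvPolynomial (Fin n) ℝ).totalDegree ≤ 2 :=
      (totalDegree_finsetSum _ _).trans <| Finset.sup_le fun i _ ↦ by simp
    calc _ ≤ _ := totalDegree_mul _ _
      _ ≤ j * 1 + k * 2 := by
        gcongr
        · exact (totalDegree_pow _ _).trans (by gcongr)
        · exact (totalDegree_pow _ _).trans (by gcongr)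
      _ = _ := by ring
  · simp [EuclideanSpace.real_norm_sq_eq, PiLp.inner_apply, mul_comm]

lemma IsEuclideanDesignTwoSpheres.sum_inner_norm {t : ℕ}
    (h : IsEuclideanDesignTwoSpheres t X₁ X₂ w r₁ r₂) (x : EuclideanSpace ℝ (Fin 22)) {j k : ℕ}
    (hjk : j + 2 * k ≤ t) :
    (∑ z ∈ X₁, w z) * (r₁ ^ (j + 2 * k) * sphereMoment j x)
        + (∑ z ∈ X₂, w z) * (r₂ ^ (j + 2 * k) * sphereMoment j x)
      = ∑ z ∈ X₁ ∪ X₂, w z * (⟪x, z⟫ ^ j * (‖z‖ ^ 2) ^ k) := by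
  obtain ⟨f, hf, he⟩ := exists_polynomial_inner_norm x j k
  have ha : ∀ r : ℝ, sphereAvg 22 r f = r ^ (j + 2 * k) * sphereMoment j x := fun r ↦ by
    have hu : ∀ u : sphere (0 : EuclideanSpace ℝ (Fin 22)) 1,
        eval (fun i ↦ r * (u : EuclideanSpace ℝ (Fin 22)) i) f
          = r ^ j * (r ^ 2) ^ k * ⟪x, (u : EuclideanSpace ℝ (Fin 22))⟫ ^ j := fun u ↦ by
      refine (he (r • (u : EuclideanSpace ℝ (Fin 22)))).trans ?_
      rw [inner_smul_right, norm_smul]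
      simp
      ring
    simp only [sphereAvg, hu, sphereMoment, average, integral_const_mul]
    ring
  have := h f (hf.trans hjk)
  rw [ha, ha] at this
  rw [this]
  exact Finset.sum_congr rfl fun z _ ↦ by rw [he]

/-- A Euclidean 6-design with positive weights on two spheres of distinct positive radii. -/
structure TwoSphereDesign (X₁ X₂ : Finset (EuclideanSpace ℝ (Fin 22)))
    (w : EuclideanSpace ℝ (Fin 22) → ℝ) (r₁ r₂ : ℝ) : Prop where
  pos₁ : 0 < r₁
  pos₂ : 0 < r₂
  ne : r₁ ≠ r₂
  norm₁ : ∀ x ∈ X₁, ‖x‖ = r₁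
  norm₂ : ∀ x ∈ X₂, ‖x‖ = r₂
  weight_pos : ∀ x ∈ X₁ ∪ X₂, 0 < w x
  design : IsEuclideanDesignTwoSpheres 6 X₁ X₂ w r₁ r₂

namespace TwoSphereDesign

lemma symm (h : TwoSphereDesign X₁ X₂ w r₁ r₂) : TwoSphereDesign X₂ X₁ w r₂ r₁ where
  pos₁ := h.pos₂
  pos₂ := h.pos₁
  ne := h.ne.symm
  norm₁ := h.norm₂
  norm₂ := h.norm₁
  weight_pos x hx := h.weight_pos x (by rwa [Finset.union_comm])
  design f hf := by rw [Finset.union_comm, ← h.design f hf, add_comm]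

lemma disjoint (h : TwoSphereDesign X₁ X₂ w r₁ r₂) : Disjoint X₁ X₂ :=
  Finset.disjoint_left.2 fun x h1 h2 ↦ h.ne ((h.norm₁ x h1).symm.trans (h.norm₂ x h2))

lemma weight_pos₁ (h : TwoSphereDesign X₁ X₂ w r₁ r₂) {x} (hx : x ∈ X₁) : 0 < w x :=
  h.weight_pos x (Finset.mem_union_left _ hx)

lemma sum_inner (h : TwoSphereDesign X₁ X₂ w r₁ r₂) (x : EuclideanSpace ℝ (Fin 22)) {j : ℕ}
    (hj : j ≤ 6) :
    ∑ z ∈ X₁, w z * ⟪x, z⟫ ^ j + ∑ z ∈ X₂, w z * ⟪x, z⟫ ^ j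
      = ((∑ z ∈ X₁, w z) * r₁ ^ j + (∑ z ∈ X₂, w z) * r₂ ^ j) * sphereMoment j x := by
  have := h.design.sum_inner_norm x (j := j) (k := 0) hj
  rw [Finset.sum_union h.disjoint] at this
  simp only [pow_zero, mul_one, mul_zero, add_zero] at this
  rw [← this]
  ring

/-- Each fiber, with the given weights, is a spherical 4-design. -/
lemma sum_inner_fiber (h : TwoSphereDesign X₁ X₂ w r₁ r₂) (x : EuclideanSpace ℝ (Fin 22)) {j : ℕ}
    (hj : j ≤ 4) :
    ∑ z ∈ X₁, w z * ⟪x, z⟫ ^ j = (∑ z ∈ X₁, w z) * r₁ ^ j * sphereMoment j x := by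
  have h0 := h.sum_inner x (j := j) (by omega)
  have h1 := h.design.sum_inner_norm x (j := j) (k := 1) (by omega)
  rw [Finset.sum_union h.disjoint] at h1
  have e1 : ∑ z ∈ X₁, w z * (⟪x, z⟫ ^ j * (‖z‖ ^ 2) ^ 1) = r₁ ^ 2 * ∑ z ∈ X₁, w z * ⟪x, z⟫ ^ j := by
    rw [Finset.mul_sum]
    exact Finset.sum_congr rfl fun z hz ↦ by rw [h.norm₁ z hz]; ring
  have e2 : ∑ z ∈ X₂, w z * (⟪x, z⟫ ^ j * (‖z‖ ^ 2) ^ 1) = r₂ ^ 2 * ∑ z ∈ X₂, w z * ⟪x, z⟫ ^ j := by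
    rw [Finset.mul_sum]
    exact Finset.sum_congr rfl fun z hz ↦ by rw [h.norm₂ z hz]; ring
  rw [e1, e2] at h1
  have hne : r₁ ^ 2 - r₂ ^ 2 ≠ 0 := by
    rw [sub_ne_zero]
    intro hh
    exact h.ne ((pow_left_inj₀ h.pos₁.le h.pos₂.le two_ne_zero).1 hh)
  apply mul_left_cancel₀ hne
  rw [pow_add, pow_add] at h1
  linear_combination (-r₂ ^ 2) * h0 - h1

lemma sum_cubic_sq (s : Finset (EuclideanSpace ℝ (Fin 22))) (x : EuclideanSpace ℝ (Fin 22))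
    (a b c d : ℝ) :
    ∑ z ∈ s, w z * (a + b * ⟪x, z⟫ + c * ⟪x, z⟫ ^ 2 + d * ⟪x, z⟫ ^ 3) ^ 2
      = a ^ 2 * ∑ z ∈ s, w z * ⟪x, z⟫ ^ 0 + 2 * a * b * ∑ z ∈ s, w z * ⟪x, z⟫ ^ 1
        + (b ^ 2 + 2 * a * c) * ∑ z ∈ s, w z * ⟪x, z⟫ ^ 2
        + (2 * a * d + 2 * b * c) * ∑ z ∈ s, w z * ⟪x, z⟫ ^ 3
        + (c ^ 2 + 2 * b * d) * ∑ z ∈ s, w z * ⟪x, z⟫ ^ 4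
        + 2 * c * d * ∑ z ∈ s, w z * ⟪x, z⟫ ^ 5 + d ^ 2 * ∑ z ∈ s, w z * ⟪x, z⟫ ^ 6 := by
  simp only [Finset.mul_sum, ← Finset.sum_add_distrib]
  exact Finset.sum_congr rfl fun z _ ↦ by ring

/-- The diagonal value, on the first sphere, of the reproducing kernel of the polynomials of
degree at most three on two spheres of radii `r₁`, `r₂` and masses `W₁`, `W₂`. -/
noncomputable def kernelDiag (W₁ W₂ r₁ r₂ : ℝ) : ℝ :=
  23 / W₁ + 252 * r₁ ^ 4 / (W₁ * r₁ ^ 4 + W₂ * r₂ ^ 4)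
    + 2002 * r₁ ^ 6 / (W₁ * r₁ ^ 6 + W₂ * r₂ ^ 6)

/-- The reproducing kernel between two points with inner product `s` on the first sphere. -/
noncomputable def kernelSame (W₁ W₂ r₁ r₂ s : ℝ) : ℝ :=
  (1 + 22 * s / r₁ ^ 2) / W₁
    + 264 / (W₁ * r₁ ^ 4 + W₂ * r₂ ^ 4) * (s ^ 2 - r₁ ^ 4 / 22)
    + 2288 / (W₁ * r₁ ^ 6 + W₂ * r₂ ^ 6) * (s ^ 3 - s * r₁ ^ 4 / 8)

/-- The reproducing kernel between points with inner product `s` on the two spheres. -/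
noncomputable def kernelCross (W₁ W₂ r₁ r₂ s : ℝ) : ℝ :=
  264 / (W₁ * r₁ ^ 4 + W₂ * r₂ ^ 4) * (s ^ 2 - r₁ ^ 2 * r₂ ^ 2 / 22)
    + 2288 / (W₁ * r₁ ^ 6 + W₂ * r₂ ^ 6) * (s ^ 3 - s * (r₁ ^ 2 * r₂ ^ 2) / 8)

lemma sum_kernel_sq (h : TwoSphereDesign X₁ X₂ w r₁ r₂) {x : EuclideanSpace ℝ (Fin 22)}
    (hx : ‖x‖ = r₁) {W₁ W₂ : ℝ} (hW₁ : ∑ z ∈ X₁, w z = W₁) (hW₂ : ∑ z ∈ X₂, w z = W₂)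
    (hp₁ : 0 < W₁) (hp₂ : 0 < W₂) :
    ∑ z ∈ X₁, w z * kernelSame W₁ W₂ r₁ r₂ ⟪x, z⟫ ^ 2
      + ∑ z ∈ X₂, w z * kernelCross W₁ W₂ r₁ r₂ ⟪x, z⟫ ^ 2 = kernelDiag W₁ W₂ r₁ r₂ := by
  have hr₁ := h.pos₁
  have hr₂ := h.pos₂
  obtain ⟨a, ha⟩ : ∃ a, a = (W₁ * r₁ ^ 4 + W₂ * r₂ ^ 4)⁻¹ := ⟨_, rfl⟩
  obtain ⟨b, hb⟩ : ∃ b, b = (W₁ * r₁ ^ 6 + W₂ * r₂ ^ 6)⁻¹ := ⟨_, rfl⟩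
  obtain ⟨v, hv⟩ : ∃ v, v = W₁⁻¹ := ⟨_, rfl⟩
  obtain ⟨q, hq⟩ : ∃ q, q = (r₁ ^ 2)⁻¹ := ⟨_, rfl⟩
  have hv' : v * W₁ = 1 := by rw [hv]; exact inv_mul_cancel₀ (by positivity)
  have hq' : q * r₁ ^ 2 = 1 := by rw [hq]; exact inv_mul_cancel₀ (by positivity)
  have ha' : a * (W₁ * r₁ ^ 4 + W₂ * r₂ ^ 4) = 1 := by
    rw [ha]; exact inv_mul_cancel₀ (by positivity)
  have hb' : b * (W₁ * r₁ ^ 6 + W₂ * r₂ ^ 6) = 1 := by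
    rw [hb]; exact inv_mul_cancel₀ (by positivity)
  have e1 : ∀ s, kernelSame W₁ W₂ r₁ r₂ s = (v - 12 * a * r₁ ^ 4)
      + (22 * q * v - 286 * b * r₁ ^ 4) * s + 264 * a * s ^ 2 + 2288 * b * s ^ 3 :=
    fun s ↦ by
      rw [kernelSame, div_eq_mul_inv 264, div_eq_mul_inv 2288, ← ha, ← hb, div_eq_mul_inv _ W₁,
        ← hv, div_eq_mul_inv _ (r₁ ^ 2), ← hq]
      ring
  have e2 : ∀ s, kernelCross W₁ W₂ r₁ r₂ s = (-12 * a * r₁ ^ 2 * r₂ ^ 2)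
      + (-286 * b * r₁ ^ 2 * r₂ ^ 2) * s + 264 * a * s ^ 2 + 2288 * b * s ^ 3 := fun s ↦ by
    rw [kernelCross, div_eq_mul_inv 264, div_eq_mul_inv 2288, ← ha, ← hb]
    ring
  have e3 : kernelDiag W₁ W₂ r₁ r₂ = 23 * v + 252 * r₁ ^ 4 * a + 2002 * r₁ ^ 6 * b := by
    rw [kernelDiag, ha, hb, hv]
    rfl
  simp only [e1, e2, e3]
  obtain ⟨m2, m4, m6⟩ := sphereMoment_values x
  rw [hx] at m2 m4 m6
  have m0 := sphereMoment_zero x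
  have m1 := sphereMoment_eq_zero (by decide : Odd 1) x
  have m3 := sphereMoment_eq_zero (by decide : Odd 3) x
  have m5 := sphereMoment_eq_zero (by decide : Odd 5) x
  have f₁ := fun j (hj : j ≤ 4) ↦ h.sum_inner_fiber x hj
  have f₂ := fun j (hj : j ≤ 4) ↦ h.symm.sum_inner_fiber x hj
  have t5 := h.sum_inner x (j := 5) (by norm_num)
  have t6 := h.sum_inner x (j := 6) (by norm_num)
  rw [sum_cubic_sq, sum_cubic_sq, f₁ 0 (by norm_num), f₁ 1 (by norm_num), f₁ 2 (by norm_num),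
    f₁ 3 (by norm_num), f₁ 4 (by norm_num), f₂ 0 (by norm_num), f₂ 1 (by norm_num),
    f₂ 2 (by norm_num), f₂ 3 (by norm_num), f₂ 4 (by norm_num), m0, m1, m2, m3, m4]
  rw [m5] at t5
  rw [m6] at t6
  rw [hW₁, hW₂] at *
  linear_combination (2 * (264 * a) * (2288 * b)) * t5 + (2288 * b) ^ 2 * t6
    + 252 * a * r₁ ^ 4 * ha' + 2002 * b * r₁ ^ 6 * hb' + 23 * v * hv'
    + 22 * W₁ * v ^ 2 * (q * r₁ ^ 2 + 1) * hq'

lemma kernelDiag_eq {W₁ W₂ : ℝ} (hr₁ : r₁ ≠ 0) :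
    kernelSame W₁ W₂ r₁ r₂ (r₁ ^ 2) = kernelDiag W₁ W₂ r₁ r₂ := by
  rw [kernelSame, kernelDiag, mul_div_assoc, div_self (by positivity)]
  ring

lemma kernelDiag_pos {W₁ W₂ : ℝ} (hr₁ : 0 < r₁) (hr₂ : 0 < r₂) (hp₁ : 0 < W₁) (hp₂ : 0 < W₂) :
    0 < kernelDiag W₁ W₂ r₁ r₂ := by
  unfold kernelDiag
  positivity

lemma mul_kernelDiag_add {W₁ W₂ : ℝ} (hr₁ : 0 < r₁) (hr₂ : 0 < r₂) (hp₁ : 0 < W₁)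
    (hp₂ : 0 < W₂) :
    W₁ * kernelDiag W₁ W₂ r₁ r₂ + W₂ * kernelDiag W₂ W₁ r₂ r₁ = 2300 := by
  unfold kernelDiag
  rw [add_comm (W₂ * r₂ ^ 4), add_comm (W₂ * r₂ ^ 6)]
  field_simp
  ring

lemma weight_kernel_le (h : TwoSphereDesign X₁ X₂ w r₁ r₂) {x : EuclideanSpace ℝ (Fin 22)}
    (hx : x ∈ X₁) {W₁ W₂ : ℝ} (hW₁ : ∑ z ∈ X₁, w z = W₁) (hW₂ : ∑ z ∈ X₂, w z = W₂)
    (hp₁ : 0 < W₁) (hp₂ : 0 < W₂) :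
    w x * kernelDiag W₁ W₂ r₁ r₂ ^ 2 + ∑ z ∈ X₂, w z * kernelCross W₁ W₂ r₁ r₂ ⟪x, z⟫ ^ 2
      ≤ kernelDiag W₁ W₂ r₁ r₂ := by
  refine le_trans ?_ (h.sum_kernel_sq (h.norm₁ x hx) hW₁ hW₂ hp₁ hp₂).le
  gcongr
  have hxx : ⟪x, x⟫ = r₁ ^ 2 := by rw [real_inner_self_eq_norm_sq, h.norm₁ x hx]
  have := Finset.single_le_sum (f := fun z ↦ w z * kernelSame W₁ W₂ r₁ r₂ ⟪x, z⟫ ^ 2)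
    (fun z hz ↦ mul_nonneg (h.weight_pos₁ hz).le (sq_nonneg _)) hx
  simpa only [hxx, kernelDiag_eq h.pos₁.ne'] using this

lemma weight_mul_kernelDiag_le (h : TwoSphereDesign X₁ X₂ w r₁ r₂)
    {x : EuclideanSpace ℝ (Fin 22)} (hx : x ∈ X₁) {W₁ W₂ : ℝ} (hW₁ : ∑ z ∈ X₁, w z = W₁)
    (hW₂ : ∑ z ∈ X₂, w z = W₂) (hp₁ : 0 < W₁) (hp₂ : 0 < W₂) :
    w x * kernelDiag W₁ W₂ r₁ r₂ ≤ 1 := by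
  have h1 := h.weight_kernel_le hx hW₁ hW₂ hp₁ hp₂
  have h2 : 0 ≤ ∑ z ∈ X₂, w z * kernelCross W₁ W₂ r₁ r₂ ⟪x, z⟫ ^ 2 :=
    Finset.sum_nonneg fun z hz ↦ mul_nonneg (h.symm.weight_pos₁ hz).le (sq_nonneg _)
  have h3 := kernelDiag_pos h.pos₁ h.pos₂ hp₁ hp₂
  refine le_of_mul_le_mul_right ?_ h3
  linarith

/-- A design with as many points as the dimension of the cubic polynomials is tight: the weight of
a point is the inverse of the diagonal value of the reproducing kernel. -/
lemma weight_mul_kernelDiag (h : TwoSphereDesign X₁ X₂ w r₁ r₂) (hcard : (X₁ ∪ X₂).card = 2300)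
    {x : EuclideanSpace ℝ (Fin 22)} (hx : x ∈ X₁) {W₁ W₂ : ℝ} (hW₁ : ∑ z ∈ X₁, w z = W₁)
    (hW₂ : ∑ z ∈ X₂, w z = W₂) (hp₁ : 0 < W₁) (hp₂ : 0 < W₂) :
    w x * kernelDiag W₁ W₂ r₁ r₂ = 1 := by
  refine le_antisymm (h.weight_mul_kernelDiag_le hx hW₁ hW₂ hp₁ hp₂) ?_
  by_contra! hlt
  have h1 : W₁ * kernelDiag W₁ W₂ r₁ r₂ < X₁.card := by
    rw [← hW₁, Finset.sum_mul, hW₁, Finset.cast_card]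
    exact Finset.sum_lt_sum (fun z hz ↦ h.weight_mul_kernelDiag_le hz hW₁ hW₂ hp₁ hp₂)
      ⟨x, hx, hlt⟩
  have h2 : W₂ * kernelDiag W₂ W₁ r₂ r₁ ≤ X₂.card := by
    rw [← hW₂, Finset.sum_mul, hW₂, Finset.cast_card]
    exact Finset.sum_le_sum fun z hz ↦ h.symm.weight_mul_kernelDiag_le hz hW₂ hW₁ hp₂ hp₁
  have h3 := mul_kernelDiag_add h.pos₁ h.pos₂ hp₁ hp₂
  rw [Finset.card_union_of_disjoint h.disjoint] at hcard
  have h4 : (X₁.card : ℝ) + X₂.card = 2300 := by exact_mod_cast hcard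
  linarith

lemma kernelCross_eq_zero (h : TwoSphereDesign X₁ X₂ w r₁ r₂) (hcard : (X₁ ∪ X₂).card = 2300)
    {x y : EuclideanSpace ℝ (Fin 22)} (hx : x ∈ X₁) (hy : y ∈ X₂) {W₁ W₂ : ℝ}
    (hW₁ : ∑ z ∈ X₁, w z = W₁) (hW₂ : ∑ z ∈ X₂, w z = W₂) (hp₁ : 0 < W₁) (hp₂ : 0 < W₂) :
    kernelCross W₁ W₂ r₁ r₂ ⟪x, y⟫ = 0 := by
  have h1 := h.weight_kernel_le hx hW₁ hW₂ hp₁ hp₂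
  have h2 := h.weight_mul_kernelDiag hcard hx hW₁ hW₂ hp₁ hp₂
  have h3 := Finset.single_le_sum (f := fun z ↦ w z * kernelCross W₁ W₂ r₁ r₂ ⟪x, z⟫ ^ 2)
    (fun z hz ↦ mul_nonneg (h.symm.weight_pos₁ hz).le (sq_nonneg _)) hy
  rw [sq, ← mul_assoc, h2, one_mul] at h1
  have h4 : kernelCross W₁ W₂ r₁ r₂ ⟪x, y⟫ ^ 2 ≤ 0 := by
    refine le_of_mul_le_mul_left ?_ (h.symm.weight_pos₁ hy)
    linarith
  exact pow_eq_zero_iff two_ne_zero |>.1 (le_antisymm h4 (sq_nonneg _))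

/-- Normalized inner products between the two fibers are roots of a common cubic. -/
lemma exists_cubic (h : TwoSphereDesign X₁ X₂ w r₁ r₂) (hcard : (X₁ ∪ X₂).card = 2300)
    (h₁ : X₁.Nonempty) (h₂ : X₂.Nonempty) :
    ∃ γ : ℝ, 0 < γ ∧ ∀ x ∈ X₁, ∀ y ∈ X₂, (⟪x, y⟫ / (r₁ * r₂)) ^ 3
      + γ * (⟪x, y⟫ / (r₁ * r₂)) ^ 2 - (⟪x, y⟫ / (r₁ * r₂)) / 8 - γ / 22 = 0 := by
  have hr₁ := h.pos₁
  have hr₂ := h.pos₂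
  obtain ⟨W₁, hW₁⟩ : ∃ W, ∑ z ∈ X₁, w z = W := ⟨_, rfl⟩
  obtain ⟨W₂, hW₂⟩ : ∃ W, ∑ z ∈ X₂, w z = W := ⟨_, rfl⟩
  have hp₁ : 0 < W₁ := hW₁ ▸ Finset.sum_pos (fun z hz ↦ h.weight_pos₁ hz) h₁
  have hp₂ : 0 < W₂ := hW₂ ▸ Finset.sum_pos (fun z hz ↦ h.symm.weight_pos₁ hz) h₂
  refine ⟨3 / 26 * (W₁ * r₁ ^ 6 + W₂ * r₂ ^ 6) / ((W₁ * r₁ ^ 4 + W₂ * r₂ ^ 4) * (r₁ * r₂)),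
    by positivity, fun x hx y hy ↦ ?_⟩
  have hk := h.kernelCross_eq_zero hcard hx hy hW₁ hW₂ hp₁ hp₂
  rw [kernelCross] at hk
  obtain ⟨c, hc⟩ : ∃ c, c = ⟪x, y⟫ / (r₁ * r₂) := ⟨_, rfl⟩
  have hc' : ⟪x, y⟫ = c * (r₁ * r₂) := by rw [hc]; field_simp
  rw [← hc]
  rw [hc'] at hk
  have hD₄ : 0 < W₁ * r₁ ^ 4 + W₂ * r₂ ^ 4 := by positivity
  have hD₆ : 0 < W₁ * r₁ ^ 6 + W₂ * r₂ ^ 6 := by positivity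
  generalize W₁ * r₁ ^ 4 + W₂ * r₂ ^ 4 = D₄ at *
  generalize W₁ * r₁ ^ 6 + W₂ * r₂ ^ 6 = D₆ at *
  have e : c ^ 3 + 3 / 26 * D₆ / (D₄ * (r₁ * r₂)) * c ^ 2 - c / 8
      - 3 / 26 * D₆ / (D₄ * (r₁ * r₂)) / 22 = D₆ / (2288 * (r₁ * r₂) ^ 3)
        * (264 / D₄ * ((c * (r₁ * r₂)) ^ 2 - r₁ ^ 2 * r₂ ^ 2 / 22)
        + 2288 / D₆ * ((c * (r₁ * r₂)) ^ 3 - c * (r₁ * r₂) * (r₁ ^ 2 * r₂ ^ 2) / 8)) := by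
    field_simp
    ring
  rw [e, hk, mul_zero]

/-- The unweighted moments of the first fiber, with respect to a point of the second one. -/
lemma sum_normalized_inner (h : TwoSphereDesign X₁ X₂ w r₁ r₂) (hcard : (X₁ ∪ X₂).card = 2300)
    (h₁ : X₁.Nonempty) (h₂ : X₂.Nonempty) {y : EuclideanSpace ℝ (Fin 22)} (hy : y ∈ X₂) :
    ∑ x ∈ X₁, ⟪x, y⟫ / (r₁ * r₂) = 0 ∧
      ∑ x ∈ X₁, (⟪x, y⟫ / (r₁ * r₂)) ^ 2 = (X₁.card : ℝ) / 22 := by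
  have hr₁ := h.pos₁
  have hr₂ := h.pos₂
  obtain ⟨W₁, hW₁⟩ : ∃ W, ∑ z ∈ X₁, w z = W := ⟨_, rfl⟩
  obtain ⟨W₂, hW₂⟩ : ∃ W, ∑ z ∈ X₂, w z = W := ⟨_, rfl⟩
  have hp₁ : 0 < W₁ := hW₁ ▸ Finset.sum_pos (fun z hz ↦ h.weight_pos₁ hz) h₁
  have hp₂ : 0 < W₂ := hW₂ ▸ Finset.sum_pos (fun z hz ↦ h.symm.weight_pos₁ hz) h₂
  obtain ⟨a, ha⟩ : ∃ a, a = (kernelDiag W₁ W₂ r₁ r₂)⁻¹ := ⟨_, rfl⟩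
  have hw : ∀ x ∈ X₁, w x = a := fun x hx ↦ by
    rw [ha]
    exact eq_inv_of_mul_eq_one_left (h.weight_mul_kernelDiag hcard hx hW₁ hW₂ hp₁ hp₂)
  have ha0 : a ≠ 0 := by
    rw [ha]
    exact inv_ne_zero (kernelDiag_pos hr₁ hr₂ hp₁ hp₂).ne'
  have hf : ∀ j ≤ 4, ∑ x ∈ X₁, ⟪x, y⟫ ^ j = X₁.card * r₁ ^ j * sphereMoment j y := fun j hj ↦ by
    have := h.sum_inner_fiber y hj
    rw [Finset.sum_congr rfl fun x hx ↦ by rw [hw x hx, real_inner_comm], ← Finset.mul_sum,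
      Finset.sum_congr rfl hw, Finset.sum_const, nsmul_eq_mul] at this
    apply mul_left_cancel₀ ha0
    rw [this]
    ring
  constructor
  · have := hf 1 (by norm_num)
    rw [sphereMoment_eq_zero (by decide)] at this
    simp only [pow_one, mul_zero] at this
    rw [← Finset.sum_div, this, zero_div]
  · have := hf 2 (by norm_num)
    rw [(sphereMoment_values y).1, h.norm₂ y hy] at this
    simp only [div_pow]
    rw [← Finset.sum_div, this]
    field_simp

end TwoSphereDesign

end Design

/-- A quadrature of degree two supported on the roots of `c ^ 3 + γ c ^ 2 - c / 8 - γ / 22`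
has prescribed multiplicities. -/
lemma card_filter_eq_root {α : Type*} {s : Finset α} {c : α → ℝ} {γ a : ℝ}
    (h1 : ∑ i ∈ s, c i = 0) (h2 : ∑ i ∈ s, c i ^ 2 = (s.card : ℝ) / 22)
    (hc : ∀ i ∈ s, c i ^ 3 + γ * c i ^ 2 - c i / 8 - γ / 22 = 0)
    (ha : a ^ 3 + γ * a ^ 2 - a / 8 - γ / 22 = 0) :
    ((s.filter fun i ↦ c i = a).card : ℝ) * (11 * (1 - 2 * a ^ 2 + 176 * a ^ 4))
      = 7 * s.card := by
  have hs : ∑ i ∈ s, (c i ^ 2 + (γ + a) * c i + (a ^ 2 + γ * a - 1 / 8))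
      = (s.filter fun i ↦ c i = a).card * (3 * a ^ 2 + 2 * γ * a - 1 / 8) := by
    rw [← nsmul_eq_mul, ← Finset.sum_const, Finset.sum_filter]
    refine Finset.sum_congr rfl fun i hi ↦ ?_
    split_ifs with hia
    · rw [hia]
      ring
    · apply mul_left_cancel₀ (sub_ne_zero.2 hia)
      linear_combination hc i hi - ha
  rw [Finset.sum_add_distrib, Finset.sum_add_distrib, ← Finset.mul_sum, h1, h2, Finset.sum_const,
    nsmul_eq_mul] at hs
  linear_combination 1936 * (1 / 22 - a ^ 2) * hs
    + (1936 * s.card * a - 1936 * (s.filter fun i ↦ c i = a).card * 2 * a) * ha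

lemma cubic_param_eq {γ : ℝ} (hγ : 0 < γ)
    (h : ∀ a : ℝ, a ^ 3 + γ * a ^ 2 - a / 8 - γ / 22 = 0 →
      ∃ k : ℕ, (k : ℝ) * (11 * (1 - 2 * a ^ 2 + 176 * a ^ 4)) = 175) :
    γ = 3 / (4 * Real.sqrt 11) := by
  have hcont : Continuous fun a : ℝ ↦ a ^ 3 + γ * a ^ 2 - a / 8 - γ / 22 := by fun_prop
  obtain ⟨s, hs0, hs⟩ : ∃ s : ℝ, 0 < s ∧ s ^ 2 = 1 / 22 :=
    ⟨Real.sqrt (1 / 22), by positivity, Real.sq_sqrt (by norm_num)⟩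
  obtain ⟨a, ⟨ha1, ha2⟩, ha⟩ : ∃ a ∈ Set.Icc (-s) 0, a ^ 3 + γ * a ^ 2 - a / 8 - γ / 22 = 0 := by
    refine intermediate_value_Icc' (by linarith) hcont.continuousOn ⟨?_, ?_⟩
    · linarith
    · have : (-s) ^ 3 + γ * (-s) ^ 2 - -s / 8 - γ / 22 = s * (1 / 8 - 1 / 22) := by
        linear_combination (γ - s) * hs
      rw [this]
      nlinarith
  have hat : a ^ 2 ≤ 1 / 22 := by rw [← hs]; nlinarith
  have ha0 : a < 0 := by
    refine lt_of_le_of_ne ha2 ?_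
    rintro rfl
    linarith
  obtain ⟨k, hk⟩ := h a ha
  have hk16 : k ≤ 16 := by
    have : (k : ℝ) ≤ 16 := by
      nlinarith [sq_nonneg (a ^ 2 - 1 / 176), Nat.cast_nonneg (α := ℝ) k]
    exact_mod_cast this
  have hk' : k = 16 := by
    by_contra hne
    have h15 : (k : ℝ) ≤ 15 := by exact_mod_cast (by omega : k ≤ 15)
    have hq : 35 / 33 ≤ 1 - 2 * a ^ 2 + 176 * a ^ 4 := by
      have : 0 < 1 - 2 * a ^ 2 + 176 * a ^ 4 := by nlinarith [sq_nonneg (a ^ 2 - 1 / 176)]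
      nlinarith
    have h225 : 9 / 400 ≤ a ^ 2 := by
      by_contra! hlt
      nlinarith [sq_nonneg a]
    have ha15 : a ≤ -3 / 20 := by nlinarith
    have hγ' : 1 / 2 ≤ γ := by
      have h3 : γ * (1 / 22 - a ^ 2) = -a * (1 / 8 - a ^ 2) := by linear_combination -ha
      by_contra! hlt
      nlinarith
    obtain ⟨b, ⟨hb1, hb2⟩, hb⟩ : ∃ b ∈ Set.Icc (-γ - 1) (-3 / 5),
        b ^ 3 + γ * b ^ 2 - b / 8 - γ / 22 = 0 := by
      refine intermediate_value_Icc (by linarith) hcont.continuousOn ⟨?_, ?_⟩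
      · nlinarith
      · linarith
    obtain ⟨l, hl⟩ := h b hb
    have hb36 : 9 / 25 ≤ b ^ 2 := by nlinarith
    have hD : 175 < 11 * (1 - 2 * b ^ 2 + 176 * b ^ 4) := by nlinarith
    rcases Nat.eq_zero_or_pos l with rfl | hl0
    · norm_num at hl
    · have : (1 : ℝ) ≤ l := by exact_mod_cast hl0
      nlinarith
  have hat : a ^ 2 = 1 / 176 := by
    rw [hk'] at hk
    push_cast at hk
    have : (a ^ 2 - 1 / 176) ^ 2 = 0 := by linear_combination hk / 30976
    exact sub_eq_zero.1 (pow_eq_zero_iff two_ne_zero |>.1 this)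
  have h11 : Real.sqrt 11 ^ 2 = 11 := Real.sq_sqrt (by norm_num)
  have hpos : 0 < Real.sqrt 11 := by positivity
  have hγa : γ = -3 * a := by linear_combination (-176 / 7) * ha + 176 / 7 * (a + γ) * hat
  have has : a * (4 * Real.sqrt 11) = -1 := by
    have h1 : (a * (4 * Real.sqrt 11) + 1) * (a * (4 * Real.sqrt 11) - 1) = 0 := by
      linear_combination 16 * Real.sqrt 11 ^ 2 * hat + 1 / 11 * h11
    rcases mul_eq_zero.1 h1 with h1 | h1
    · linarith
    · nlinarith [mul_neg_of_neg_of_pos ha0 hpos]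
  rw [eq_div_iff (by positivity), hγa]
  linear_combination (-3) * has

/-- each point of `X₁` has inner product `r₁r₂/√11` with exactly 567 points
of `X₂`, `-r₁r₂/(4√11)` with exactly 1296 points, and `-3r₁r₂/(2√11)` with exactly 162. -/
theorem statement9
    {X₁ X₂ : Finset (EuclideanSpace ℝ (Fin 22))} {w : EuclideanSpace ℝ (Fin 22) → ℝ}
    {r₁ r₂ : ℝ} (hr₁ : 0 < r₁) (hr₂ : 0 < r₂) (hrne : r₁ ≠ r₂)
    (hX₁ : ∀ x ∈ X₁, ‖x‖ = r₁) (hX₂ : ∀ x ∈ X₂, ‖x‖ = r₂)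
    (hw : ∀ x ∈ X₁ ∪ X₂, 0 < w x)
    (hcard : (X₁ ∪ X₂).card = 2300) (hcard₁ : X₁.card = 275)
    (hdesign : IsEuclideanDesignTwoSpheres 6 X₁ X₂ w r₁ r₂) :
    ∀ x ∈ X₁,
      (X₂.filter fun y => ⟪x, y⟫ = r₁ * r₂ / Real.sqrt 11).card = 567 ∧
      (X₂.filter fun y => ⟪x, y⟫ = -(r₁ * r₂ / (4 * Real.sqrt 11))).card = 1296 ∧
      (X₂.filter fun y => ⟪x, y⟫ = -(3 * r₁ * r₂ / (2 * Real.sqrt 11))).card = 162 := by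
  have h : TwoSphereDesign X₁ X₂ w r₁ r₂ := ⟨hr₁, hr₂, hrne, hX₁, hX₂, hw, hdesign⟩
  have hcard' : (X₂ ∪ X₁).card = 2300 := by rwa [Finset.union_comm]
  have hcard₂ : X₂.card = 2025 := by
    rw [Finset.card_union_of_disjoint h.disjoint, hcard₁] at hcard
    omega
  have h₁ : X₁.Nonempty := Finset.card_pos.1 (by omega)
  have h₂ : X₂.Nonempty := Finset.card_pos.1 (by omega)
  obtain ⟨γ, hγ, hroot⟩ := h.exists_cubic hcard h₁ h₂
  have hcount : ∀ x ∈ X₁, ∀ a : ℝ, a ^ 3 + γ * a ^ 2 - a / 8 - γ / 22 = 0 →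
      ((X₂.filter fun y ↦ ⟪x, y⟫ / (r₁ * r₂) = a).card : ℝ)
        * (11 * (1 - 2 * a ^ 2 + 176 * a ^ 4)) = 14175 := fun x hx a ha ↦ by
    obtain ⟨s1, s2⟩ := h.symm.sum_normalized_inner hcard' h₂ h₁ hx
    simp only [real_inner_comm x, mul_comm r₂ r₁] at s1 s2
    rw [card_filter_eq_root s1 s2 (hroot x hx) ha, hcard₂]
    norm_num
  have hγ' : γ = 3 / (4 * Real.sqrt 11) := by
    refine cubic_param_eq hγ fun a ha ↦ ?_
    obtain ⟨x, hx⟩ := h₁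
    obtain ⟨y, hy⟩ := h₂
    have hn := hcount x hx a ha
    obtain ⟨s1, s2⟩ := h.sum_normalized_inner hcard ⟨x, hx⟩ ⟨y, hy⟩ hy
    have hm := card_filter_eq_root s1 s2 (fun x hx ↦ hroot x hx y hy) ha
    rw [hcard₁] at hm
    generalize (X₂.filter fun y ↦ ⟪x, y⟫ / (r₁ * r₂) = a).card = n at hn
    generalize (X₁.filter fun x ↦ ⟪x, y⟫ / (r₁ * r₂) = a).card = m at hm
    have hD : 11 * (1 - 2 * a ^ 2 + 176 * a ^ 4) ≠ 0 := by
      intro h0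
      rw [h0] at hn
      norm_num at hn
    have hnm : 11 * n = 81 * m := by
      have : (11 : ℝ) * n = 81 * m := by
        apply mul_right_cancel₀ hD
        push_cast at hm
        linear_combination 11 * hn - 81 * hm
      exact_mod_cast this
    refine ⟨m / 11, ?_⟩
    have hm11 : m = 11 * (m / 11) := by omega
    have : (m : ℝ) = 11 * ((m / 11 : ℕ) : ℝ) := by exact_mod_cast hm11
    rw [this] at hm
    push_cast at hm ⊢
    linear_combination hm / 11
  intro x hx
  have hs : Real.sqrt 11 ^ 2 = 11 := Real.sq_sqrt (by norm_num)
  obtain ⟨t, ht⟩ : ∃ t, t = (Real.sqrt 11)⁻¹ := ⟨_, rfl⟩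
  have ht2 : t ^ 2 = 1 / 11 := by rw [ht, inv_pow, hs, one_div]
  have hγt : γ = 3 / 4 * t := by
    rw [hγ', ht]
    field_simp
  have hr : r₁ * r₂ ≠ 0 := by positivity
  have ht3 : t ^ 3 = t / 11 := by linear_combination t * ht2
  have ht4 : t ^ 4 = 1 / 121 := by linear_combination (t ^ 2 + 1 / 11) * ht2
  have key : ∀ b v : ℝ, ∀ n : ℕ, v = b * t * (r₁ * r₂) →
      b ^ 3 + 3 / 4 * b ^ 2 - 11 / 8 * b - 3 / 8 = 0 →
      (n : ℝ) * (11 - 2 * b ^ 2 + 16 * b ^ 4) = 14175 →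
      (X₂.filter fun y ↦ ⟪x, y⟫ = v).card = n := fun b v n hv hb hn ↦ by
    have hb' : (b * t) ^ 3 + γ * (b * t) ^ 2 - b * t / 8 - γ / 22 = 0 := by
      rw [hγt]
      linear_combination (b ^ 3 + 3 / 4 * b ^ 2) * ht3 + t / 11 * hb
    have hc := hcount x hx _ hb'
    simp only [div_eq_iff hr, ← hv] at hc
    have hD' : 11 * (1 - 2 * (b * t) ^ 2 + 176 * (b * t) ^ 4) = 11 - 2 * b ^ 2 + 16 * b ^ 4 := by
      linear_combination (-22 * b ^ 2) * ht2 + 1936 * b ^ 4 * ht4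
    rw [hD'] at hc
    have hD : 11 - 2 * b ^ 2 + 16 * b ^ 4 ≠ 0 := by
      intro h0
      rw [h0] at hn
      norm_num at hn
    exact_mod_cast mul_right_cancel₀ hD (hc.trans hn.symm)
  refine ⟨key 1 _ _ ?_ ?_ ?_, key (-1 / 4) _ _ ?_ ?_ ?_, key (-3 / 2) _ _ ?_ ?_ ?_⟩
  all_goals first
    | (norm_num; done)
    | (rw [ht]; field_simp)
end
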